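/- arXiv:0909.4489 — 7 statements merged into one kernel-verified Lean document; each statement's English description precedes it below -/
import Mathlib

section
/- For any 2×2 matrices X, Y and Z over a field k of characteristic zero, tr(X·Y·X·Z) = tr(X·Y)·tr(X·Z) − det(X)·tr(Y · adjugate(Z)). -/
/-- For any 2×2 matrices `X`, `Y`, `Z` over a field `k` of characteristic zero,
`tr(X·Y·X·Z) = tr(X·Y) · tr(X·Z) − det(X) · tr(Y · adjugate(Z))`. -/
theorem trace_XYXZ_adjugate (k : Type*) [Field k] [CharZero k]
    (X Y Z : Matrix (Fin 2) (Fin 2) k) :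
    (X * Y * X * Z).trace =
      (X * Y).trace * (X * Z).trace - X.det * (Y * Z.adjugate).trace := by
  simp only [Matrix.trace_fin_two, Matrix.det_fin_two, Matrix.adjugate_fin_two,
    Matrix.mul_apply, Fin.sum_univ_two, Matrix.of_apply, Matrix.cons_val_zero,
    Matrix.cons_val_one, Matrix.cons_val', Matrix.cons_val_fin_one]
  ring
end

section
/- Let Z be the 4×4 matrix over a field k of characteristic zero written in 2×2 blocks as Z = [[A, B], [C, D]] (A, B, C, D are 2×2 matrices, A and B forming the top two rows). Then det(Z) = det(A)·det(D) + det(B)·det(C) − tr(adjugate(A) · B · adjugate(D) · C). -/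
/-- For 2×2 matrices `A`, `B`, `C`, `D` over a field `k` of characteristic zero,
assembled into the 4×4 block matrix `Z = [[A, B], [C, D]]`,
`det(Z) = det(A)·det(D) + det(B)·det(C) − tr(adjugate(A) · B · adjugate(D) · C)`. -/
theorem det_fromBlocks_two_by_two (k : Type*) [Field k] [CharZero k]
    (A B C D : Matrix (Fin 2) (Fin 2) k) :
    (Matrix.fromBlocks A B C D).det =
      A.det * D.det + B.det * C.det -
        (A.adjugate * B * D.adjugate * C).trace := by
  have reindex_eq : Matrix.reindex finSumFinEquiv finSumFinEquiv (Matrix.fromBlocks A B C D) =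
      !![A 0 0, A 0 1, B 0 0, B 0 1;
         A 1 0, A 1 1, B 1 0, B 1 1;
         C 0 0, C 0 1, D 0 0, D 0 1;
         C 1 0, C 1 1, D 1 0, D 1 1] := by
    ext i j
    fin_cases i <;> fin_cases j <;> rfl
  rw [← Matrix.det_reindex_self finSumFinEquiv, reindex_eq]
  simp only [Matrix.trace_fin_two, Matrix.mul_apply, Fin.sum_univ_two, Matrix.adjugate_fin_two]
  simp [Matrix.det_succ_row_zero, Fin.sum_univ_succ, Fin.succAbove]
  ring
end

section
/- For any 2×2 matrices X, Y, P, S over a field k of characteristic zero, tr(adjugate(X) · P · adjugate(Y) · S) = tr(X·Y)·tr(P)·tr(S) − tr(P)·tr(Y·X·S) − tr(S)·tr(X·Y·P) + tr(Y·P·X·S). -/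
/-- For any 2×2 matrices `X`, `Y`, `P`, `S` over a field `k` of characteristic zero,
`tr(adjugate(X)·P·adjugate(Y)·S)
  = tr(X·Y)·tr(P)·tr(S) − tr(P)·tr(Y·X·S) − tr(S)·tr(X·Y·P) + tr(Y·P·X·S)`. -/
theorem trace_adjugate_route (k : Type*) [Field k] [CharZero k]
    (X Y P S : Matrix (Fin 2) (Fin 2) k) :
    (X.adjugate * P * Y.adjugate * S).trace =
      (X * Y).trace * P.trace * S.trace -
        P.trace * (Y * X * S).trace -
        S.trace * (X * Y * P).trace +
        (Y * P * X * S).trace := by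
  simp only [Matrix.adjugate_fin_two, Matrix.trace_fin_two, Matrix.mul_apply, Fin.sum_univ_two,
    Matrix.of_apply, Matrix.cons_val_zero, Matrix.cons_val_one, Matrix.cons_val_fin_one]
  ring
end

section
/- Let k be a field of characteristic zero and let f be a polynomial function on the space of 2×2 matrices over k (i.e., f is a polynomial in the four matrix entries) such that f(g·X·h⁻¹) = f(X) for all X and all g, h in SL₂(k). Then f belongs to the k-subalgebra of polynomial functions generated by the single function X ↦ det(X); that is, f is a polynomial in det(X). -/
open Matrix in
/-- A matrix with nonzero upper left entry is equivalent to `diag (1, det X)`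
under left and right multiplication by `SL₂`. -/
theorem exists_sl2_mul_diagonal_mul_inv {k : Type*} [Field k]
    (X : Matrix (Fin 2) (Fin 2) k) (hX : X 0 0 ≠ 0) :
    ∃ g h : SpecialLinearGroup (Fin 2) k,
      (g : Matrix (Fin 2) (Fin 2) k) * !![1, 0; 0, X.det] *
        ((h⁻¹ : SpecialLinearGroup (Fin 2) k) : Matrix (Fin 2) (Fin 2) k) = X := by
  let g : SpecialLinearGroup (Fin 2) k :=
    ⟨!![X 0 0, 0; X 1 0, (X 0 0)⁻¹], by simp [det_fin_two_of, hX]⟩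
  let h : SpecialLinearGroup (Fin 2) k :=
    ⟨!![1, X 0 1 / X 0 0; 0, 1], by simp [det_fin_two_of]⟩
  refine ⟨g, h⁻¹, ?_⟩
  rw [inv_inv, det_fin_two]
  ext i j
  fin_cases i <;> fin_cases j <;> simp [g, h, mul_apply, Fin.sum_univ_two] <;> field_simp
  ring

/-- A polynomial over an infinite field vanishes if it vanishes wherever
a given coordinate is nonzero. -/
theorem MvPolynomial.eq_zero_of_eval_eq_zero_of_ne_zero {σ k : Type*} [Field k] [Infinite k]
    (i : σ) (p : MvPolynomial σ k) (hp : ∀ x : σ → k, x i ≠ 0 → eval x p = 0) : p = 0 := by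
  have h : X i * p = 0 := MvPolynomial.funext fun x => by
    by_cases hx : x i = 0
    · simp [hx]
    · simp [hp x hx]
  exact (mul_eq_zero.mp h).resolve_left (X_ne_zero i)

/-- Let `k` be a field of characteristic zero and `f` a polynomial function on
2×2 matrices over `k` (a polynomial in the four matrix entries) satisfying
`f (g·X·h⁻¹) = f X` for all `X` and all `g, h ∈ SL₂(k)`.  Then `f` lies in the
`k`-subalgebra of functions generated by `X ↦ det X`. -/
theorem sl2_invariants_one_matrix (k : Type) [Field k] [CharZero k]
    (f : Matrix (Fin 2) (Fin 2) k → k)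
    (hpoly : ∃ p : MvPolynomial (Fin 2 × Fin 2) k,
      ∀ X : Matrix (Fin 2) (Fin 2) k,
        f X = MvPolynomial.eval (fun ij => X ij.1 ij.2) p)
    (hinv : ∀ (X : Matrix (Fin 2) (Fin 2) k)
        (g h : Matrix.SpecialLinearGroup (Fin 2) k),
      f ((g : Matrix (Fin 2) (Fin 2) k) * X *
          ((h⁻¹ : Matrix.SpecialLinearGroup (Fin 2) k) : Matrix (Fin 2) (Fin 2) k)) = f X) :
    f ∈ Algebra.adjoin k
      ({fun X => X.det} : Set (Matrix (Fin 2) (Fin 2) k → k)) := by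
  obtain ⟨p, hp⟩ := hpoly
  let q : Polynomial k :=
    MvPolynomial.aeval (fun ij => (!![1, 0; 0, Polynomial.X] : Matrix _ _ _) ij.1 ij.2) p
  let r : MvPolynomial (Fin 2 × Fin 2) k :=
    Polynomial.aeval (MvPolynomial.X (0, 0) * MvPolynomial.X (1, 1) -
      MvPolynomial.X (0, 1) * MvPolynomial.X (1, 0)) q
  have hq (t : k) : q.eval t = f !![1, 0; 0, t] := by
    rw [hp, ← Polynomial.coe_evalRingHom]
    simp only [q, MvPolynomial.aeval_def, MvPolynomial.hom_eval₂, MvPolynomial.eval]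
    rw [MvPolynomial.coe_eval₂Hom]
    congr 1
    · ext x
      simp
    · ext ⟨i, j⟩
      fin_cases i <;> fin_cases j <;> simp
  have hr (x : Fin 2 × Fin 2 → k) :
      MvPolynomial.eval x r = q.eval (x (0, 0) * x (1, 1) - x (0, 1) * x (1, 0)) := by
    rw [← MvPolynomial.coe_aeval_eq_eval, RingHom.coe_coe, ← Polynomial.aeval_algHom_apply]
    simp
  have hpr : p - r = 0 := by
    refine MvPolynomial.eq_zero_of_eval_eq_zero_of_ne_zero (0, 0) _ fun x hx => ?_
    obtain ⟨g, h, hgh⟩ := exists_sl2_mul_diagonal_mul_inv (Matrix.of fun i j => x (i, j)) hx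
    have hf := hinv !![1, 0; 0, (Matrix.of fun i j => x (i, j)).det] g h
    rw [hgh, ← hq, hp, Matrix.det_fin_two] at hf
    rw [map_sub, hr, sub_eq_zero]
    exact hf
  have hfq : f = Polynomial.aeval (fun X : Matrix (Fin 2) (Fin 2) k => X.det) q := by
    ext X
    rw [hp, sub_eq_zero.mp hpr, hr, Polynomial.aeval_fn_apply, Matrix.det_fin_two,
      Polynomial.coe_aeval_eq_eval]
  rw [hfq]
  exact Polynomial.aeval_mem_adjoin_singleton k _
end

section
/- Let k be a field of characteristic zero and let f be a polynomial function on pairs (X, Y) of 2×2 matrices over k (i.e., f is a polynomial in the eight matrix entries) such that f(g·X·h⁻¹, g·Y·h⁻¹) = f(X, Y) for all X, Y and all g, h in SL₂(k). Then f belongs to the k-subalgebra of polynomial functions generated by the three functions (X,Y) ↦ det(X), (X,Y) ↦ det(Y), and (X,Y) ↦ tr(X · adjugate(Y)). -/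
open MvPolynomial in
/-- A polynomial in several variables vanishing wherever a nonzero polynomial does not vanish
is zero, for infinite fields. -/
lemma MvPolynomial.eq_zero_of_eval_eq_zero_of_ne {σ k : Type*} [Field k] [Infinite k]
    {p q : MvPolynomial σ k} (hq : q ≠ 0) (h : ∀ x, eval x q ≠ 0 → eval x p = 0) : p = 0 := by
  have : p * q = 0 := by
    refine MvPolynomial.funext fun x => ?_
    by_cases hx : eval x q = 0
    · simp [hx]
    · simp [h x hx]
  exact (mul_eq_zero.mp this).resolve_right hq

open MvPolynomial in
/-- A polynomial that vanishes at infinitely many points of an affine line vanishes on it. -/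
lemma MvPolynomial.eval_eq_zero_of_infinite_line {σ k : Type*} [Field k]
    (p : MvPolynomial σ k) (x v : σ → k)
    (h : {t : k | eval (fun i => x i + t * v i) p = 0}.Infinite) : eval x p = 0 := by
  set r : Polynomial k :=
    aeval (fun i => Polynomial.C (x i) + Polynomial.X * Polynomial.C (v i)) p with hr
  have key : ∀ t : k, r.eval t = eval (fun i => x i + t * v i) p := by
    intro t
    rw [hr, ← Polynomial.coe_aeval_eq_eval, ← AlgHom.comp_apply, comp_aeval, ← coe_aeval_eq_eval]
    simp [mul_comm t]
  have hz : r = 0 := by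
    refine Polynomial.eq_zero_of_infinite_isRoot r (h.mono fun t ht => ?_)
    simpa [Polynomial.IsRoot, key] using ht
  simpa [hz] using (key 0).symm

/-- If `X` is invertible and the lower left entry of `Z` is a nonzero square, then `(X, Z * X)` is
`SL₂ × SL₂`-equivalent to a pair of the form `(diag(1, a), !![0, -c; 1, b])`. -/
lemma Matrix.exists_specialLinearGroup_normal_form {k : Type*} [Field k]
    (X Z : Matrix (Fin 2) (Fin 2) k) (u : k) (hX : X.det ≠ 0) (hu : u ≠ 0) (hZ : Z 1 0 = u ^ 2) :
    ∃ (g h : Matrix.SpecialLinearGroup (Fin 2) k) (a b c : k),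
      X = (g : Matrix (Fin 2) (Fin 2) k) * !![1, 0; 0, a] *
        ((h⁻¹ : Matrix.SpecialLinearGroup (Fin 2) k) : Matrix (Fin 2) (Fin 2) k) ∧
      Z * X = (g : Matrix (Fin 2) (Fin 2) k) * !![0, -c; 1, b] *
        ((h⁻¹ : Matrix.SpecialLinearGroup (Fin 2) k) : Matrix (Fin 2) (Fin 2) k) := by
  set d := X.det with hd
  let g : Matrix.SpecialLinearGroup (Fin 2) k :=
    ⟨!![u⁻¹, Z 0 0 * u⁻¹; 0, u], by simp [Matrix.det_fin_two, hu]⟩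
  let m : Matrix (Fin 2) (Fin 2) k := !![u, -(Z 0 0 * u⁻¹); 0, d⁻¹ * u⁻¹] * X
  have hm : m.det = 1 := by
    rw [Matrix.det_mul, ← hd, Matrix.det_fin_two]
    simp
    field_simp
  have hg : g.1 * !![1, 0; 0, d] * m = X := by
    rw [← Matrix.mul_assoc, show g.1 * !![1, 0; 0, d] * !![u, -(Z 0 0 * u⁻¹); 0, d⁻¹ * u⁻¹] = 1 from
      ?_, Matrix.one_mul]
    ext i j
    fin_cases i <;> fin_cases j <;> simp [g, Matrix.mul_apply, Fin.sum_univ_two] <;>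
      field_simp <;> ring
  have hgZ : g.1 * !![0, -(Z.det * d); 1, Z.trace * d] * m = Z * X := by
    rw [← Matrix.mul_assoc]
    congr 1
    have h11 : Z.det = Z 0 0 * Z 1 1 - Z 0 1 * u ^ 2 := by rw [Matrix.det_fin_two, hZ]
    rw [h11, Matrix.trace_fin_two]
    ext i j
    fin_cases i <;> fin_cases j <;> simp [g, Matrix.mul_apply, Fin.sum_univ_two, hZ] <;>
      field_simp <;> ring
  let h : Matrix.SpecialLinearGroup (Fin 2) k := ⟨m, hm⟩
  have hh : ((h⁻¹)⁻¹ : Matrix.SpecialLinearGroup (Fin 2) k) = h := inv_inv h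
  refine ⟨g, h⁻¹, d, Z.trace * d, Z.det * d, ?_, ?_⟩
  · rw [hh]
    exact hg.symm
  · rw [hh]
    exact hgZ.symm

/-- Let `k` be a field of characteristic zero and `f` a polynomial function on
pairs `(X, Y)` of 2×2 matrices over `k` (a polynomial in the eight entries)
satisfying `f (g·X·h⁻¹, g·Y·h⁻¹) = f (X, Y)` for all `X, Y` and all
`g, h ∈ SL₂(k)`.  Then `f` lies in the `k`-subalgebra of functions generated
by `(X,Y) ↦ det X`, `(X,Y) ↦ det Y` and `(X,Y) ↦ tr(X · adjugate Y)`. -/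
theorem sl2_semi_invariants_two_arrows (k : Type) [Field k] [CharZero k]
    (f : Matrix (Fin 2) (Fin 2) k × Matrix (Fin 2) (Fin 2) k → k)
    (hpoly : ∃ p : MvPolynomial (Fin 2 × Fin 2 × Fin 2) k,
      ∀ XY : Matrix (Fin 2) (Fin 2) k × Matrix (Fin 2) (Fin 2) k,
        f XY = MvPolynomial.eval (fun i => ![XY.1, XY.2] i.1 i.2.1 i.2.2) p)
    (hinv : ∀ (XY : Matrix (Fin 2) (Fin 2) k × Matrix (Fin 2) (Fin 2) k)
        (g h : Matrix.SpecialLinearGroup (Fin 2) k),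
      f ((g : Matrix (Fin 2) (Fin 2) k) * XY.1 *
            ((h⁻¹ : Matrix.SpecialLinearGroup (Fin 2) k) : Matrix (Fin 2) (Fin 2) k),
         (g : Matrix (Fin 2) (Fin 2) k) * XY.2 *
            ((h⁻¹ : Matrix.SpecialLinearGroup (Fin 2) k) : Matrix (Fin 2) (Fin 2) k)) = f XY) :
    f ∈ Algebra.adjoin k
      ({fun XY => XY.1.det, fun XY => XY.2.det,
        fun XY => (XY.1 * XY.2.adjugate).trace} :
        Set (Matrix (Fin 2) (Fin 2) k × Matrix (Fin 2) (Fin 2) k → k)) := by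
  obtain ⟨p, hp⟩ := hpoly
  -- Restrict `p` to the slice of normal forms, giving a polynomial in the three invariants.
  let S : Fin 2 → Matrix (Fin 2) (Fin 2) (MvPolynomial (Fin 3) k) :=
    ![!![1, 0; 0, .X 0], !![0, -.X 1; 1, .X 2]]
  let q : MvPolynomial (Fin 3) k := MvPolynomial.aeval (fun i => S i.1 i.2.1 i.2.2) p
  have hq : ∀ y : Fin 3 → k, MvPolynomial.eval y q =
      f (!![1, 0; 0, y 0], !![0, -y 1; 1, y 2]) := by
    intro y
    rw [hp, ← MvPolynomial.coe_aeval_eq_eval, ← MvPolynomial.coe_aeval_eq_eval]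
    simp only [q, RingHom.coe_coe]
    rw [← AlgHom.comp_apply, MvPolynomial.comp_aeval]
    congr 2
    funext ⟨a, i, j⟩
    fin_cases a <;> fin_cases i <;> fin_cases j <;> simp [S]
  let I : Fin 3 → Matrix (Fin 2) (Fin 2) k × Matrix (Fin 2) (Fin 2) k → k :=
    ![fun XY => XY.1.det, fun XY => XY.2.det, fun XY => (XY.1 * XY.2.adjugate).trace]
  let M : Fin 2 → Matrix (Fin 2) (Fin 2) (MvPolynomial (Fin 2 × Fin 2 × Fin 2) k) :=
    fun a => .of fun i j => .X (a, i, j)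
  let J : Fin 3 → MvPolynomial (Fin 2 × Fin 2 × Fin 2) k :=
    ![(M 0).det, (M 1).det, (M 0 * (M 1).adjugate).trace]
  let P := p - MvPolynomial.aeval J q
  let e : Matrix (Fin 2) (Fin 2) k × Matrix (Fin 2) (Fin 2) k → Fin 2 × Fin 2 × Fin 2 → k :=
    fun XY i => ![XY.1, XY.2] i.1 i.2.1 i.2.2
  have he : ∀ x, ∃ XY, e XY = x := fun x =>
    ⟨(.of fun i j => x (0, i, j), .of fun i j => x (1, i, j)), by
      funext ⟨a, i, j⟩
      fin_cases a <;> simp [e]⟩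
  have hP : ∀ XY, MvPolynomial.eval (e XY) P = f XY - MvPolynomial.eval (fun i => I i XY) q := by
    intro XY
    simp only [P, map_sub]
    rw [hp XY]
    congr 1
    rw [← MvPolynomial.coe_aeval_eq_eval, ← MvPolynomial.coe_aeval_eq_eval]
    simp only [RingHom.coe_coe]
    rw [← AlgHom.comp_apply, MvPolynomial.comp_aeval]
    congr 2
    funext i
    fin_cases i <;>
      simp [I, J, M, e, Matrix.det_fin_two, Matrix.trace_fin_two, Matrix.adjugate_fin_two,
        Matrix.mul_apply, Fin.sum_univ_two]
  have hI : ∀ (i : Fin 3) (X Y : Matrix (Fin 2) (Fin 2) k)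
      (g h : Matrix.SpecialLinearGroup (Fin 2) k), I i (g.1 * X * h.1, g.1 * Y * h.1) =
        I i (X, Y) := by
    intro i X Y g h
    fin_cases i
    · simp [I, Matrix.det_mul]
    · simp [I, Matrix.det_mul]
    · simp only [I, Fin.reduceFinMk, Matrix.cons_val, Matrix.adjugate_mul_distrib]
      have h1 : h.1 * h.1.adjugate = 1 := by rw [Matrix.mul_adjugate, h.2, one_smul]
      have g1 : g.1.adjugate * g.1 = 1 := by rw [Matrix.adjugate_mul, g.2, one_smul]
      calc (g.1 * X * h.1 * (h.1.adjugate * (Y.adjugate * g.1.adjugate))).trace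
          = (g.1 * (X * (h.1 * h.1.adjugate) * Y.adjugate * g.1.adjugate)).trace := by
            simp only [Matrix.mul_assoc]
        _ = (X * Y.adjugate).trace := by
            rw [h1, Matrix.mul_one, Matrix.trace_mul_comm, Matrix.mul_assoc, g1, Matrix.mul_one]
  -- `P` vanishes on the orbits of the slice, hence generically.
  have hsq : ∀ (X Z : Matrix (Fin 2) (Fin 2) k) (u : k), X.det ≠ 0 → u ≠ 0 → Z 1 0 = u ^ 2 →
      MvPolynomial.eval (e (X, Z * X)) P = 0 := by
    intro X Z u hX hu hZ
    obtain ⟨g, h, a, b, c, h1, h2⟩ :=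
      Matrix.exists_specialLinearGroup_normal_form X Z u hX hu hZ
    rw [hP, h2, h1] 
    simp only [hI]
    rw [hinv (_, _), hq, sub_eq_zero]
    simp [I, Matrix.det_fin_two, Matrix.trace_fin_two, Matrix.adjugate_fin_two]
  have hinvble : ∀ X Y : Matrix (Fin 2) (Fin 2) k, X.det ≠ 0 →
      MvPolynomial.eval (e (X, Y)) P = 0 := by
    intro X Y hX
    let E : Matrix (Fin 2) (Fin 2) k := !![0, 0; 1, 0]
    let Z := Y * X⁻¹
    have hZ : Z * X = Y := Matrix.nonsing_inv_mul_cancel_right X Y hX.isUnit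
    refine P.eval_eq_zero_of_infinite_line _ (e (0, E * X)) ?_
    refine (Set.infinite_range_of_injective
      (f := fun n : ℕ => ((n : k) + 1) ^ 2 - Z 1 0) fun m n hmn => ?_).mono ?_
    · have : (((m + 1) ^ 2 : ℕ) : k) = ((n + 1) ^ 2 : ℕ) := by
        push_cast; exact sub_left_injective hmn
      simpa using Nat.pow_left_injective two_ne_zero (Nat.cast_injective this)
    · rintro _ ⟨n, rfl⟩
      set t := ((n : k) + 1) ^ 2 - Z 1 0 with ht
      have := hsq X (Z + t • E) (n + 1) hX (by exact_mod_cast n.succ_ne_zero) (by simp [E, ht])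
      rw [Set.mem_ofPred_eq, ← this]
      congr 2
      funext ⟨a, i, j⟩
      rw [Matrix.add_mul, hZ, Matrix.smul_mul]
      fin_cases a <;> simp [e, -mul_eq_mul_right_iff, ht]
  have hP0 : P = 0 := by
    refine MvPolynomial.eq_zero_of_eval_eq_zero_of_ne (q := (M 0).det) (fun h0 => ?_) fun x hx => ?_
    · have := congrArg (MvPolynomial.eval (e (1, 1))) h0
      simp [M, e, Matrix.det_fin_two] at this
    · obtain ⟨⟨X, Y⟩, rfl⟩ := he x
      refine hinvble X Y ?_
      simpa [M, e, Matrix.det_fin_two] using hx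
  have hf : f = MvPolynomial.aeval I q := by
    funext XY
    have h1 := hP XY
    rw [hP0, map_zero] at h1
    rw [sub_eq_zero.mp h1.symm, ← MvPolynomial.coe_aeval_eq_eval]
    exact (DFunLike.congr_fun (MvPolynomial.comp_aeval (σ := Fin 3) I
      (Pi.evalAlgHom k (fun _ => k) XY)) q).symm
  rw [hf]
  have hrange : Set.range I = {fun XY => XY.1.det, fun XY => XY.2.det,
      fun XY => (XY.1 * XY.2.adjugate).trace} := by
    simp only [I, Matrix.range_cons, Matrix.range_empty, Set.union_empty, Set.singleton_union]
  rw [← hrange, Algebra.adjoin_range_eq_range_aeval]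
  exact ⟨q, rfl⟩
end

section
/- Let k be a field of characteristic zero and let f be a polynomial function on pairs (X, Y) of 2×2 matrices over k such that f(g·X·g⁻¹, g·Y·g⁻¹) = f(X, Y) for all X, Y and all g in SL₂(k). Then f belongs to the k-subalgebra of polynomial functions generated by the five functions (X,Y) ↦ tr(X), (X,Y) ↦ tr(Y), (X,Y) ↦ tr(X·Y), (X,Y) ↦ det(X), and (X,Y) ↦ det(Y). -/
open Polynomial in
theorem Polynomial.eq_zero_of_forall_eval_quadratic_eq_zero {k : Type*} [Field k] [CharZero k]
    {U : k[X]} {x c : k} (hx : x ≠ 0) (h : ∀ t, U.eval (x * t ^ 2 + c * t) = 0) : U = 0 := by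
  have h0 : U.comp (C x * X ^ 2 + C c * X) = 0 := by
    apply Polynomial.funext
    intro t
    simpa [eval_comp] using h t
  rcases comp_eq_zero_iff.1 h0 with h1 | ⟨-, h2⟩
  · exact h1
  · have := congrArg (fun q => coeff q 2) h2
    simp [coeff_X, coeff_C] at this
    exact absurd this hx

theorem MvPolynomial.eval_bind₁ {σ τ R : Type*} [CommSemiring R] (v : τ → R)
    (m : σ → MvPolynomial τ R) (p : MvPolynomial σ R) :
    MvPolynomial.eval v (MvPolynomial.bind₁ m p) =
      MvPolynomial.eval (fun i => MvPolynomial.eval v (m i)) p :=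
  MvPolynomial.eval₂Hom_bind₁ (RingHom.id R) v m p

theorem MvPolynomial.polynomial_eval_aeval {σ R : Type*} [CommSemiring R] (t : R)
    (m : σ → Polynomial R) (p : MvPolynomial σ R) :
    (MvPolynomial.aeval m p).eval t = MvPolynomial.eval (fun i => (m i).eval t) p := by
  induction p using MvPolynomial.induction_on with
  | C r => simp
  | add p q hp hq => simp [hp, hq]
  | mul_X p i hp => simp [hp]

theorem MvPolynomial.aeval_pi_apply {σ ι R : Type*} [CommSemiring R] (m : σ → ι → R)
    (p : MvPolynomial σ R) (x : ι) :
    MvPolynomial.aeval m p x = MvPolynomial.eval (fun i => m i x) p := by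
  induction p using MvPolynomial.induction_on with
  | C r => simp
  | add p q hp hq => simp [hp, hq]
  | mul_X p i hp => simp [hp]

namespace MatrixPair

variable {k : Type*} [Field k]

/-- Being a polynomial in the eight entries of a pair of `2 × 2` matrices. -/
def IsPolynomial (f : Matrix (Fin 2) (Fin 2) k × Matrix (Fin 2) (Fin 2) k → k) : Prop :=
  ∃ p : MvPolynomial (Fin 2 × Fin 2 × Fin 2) k, ∀ XY,
    f XY = MvPolynomial.eval (fun i => ![XY.1, XY.2] i.1 i.2.1 i.2.2) p

/-- Invariance under simultaneous conjugation by `SL₂`, the conjugating matrix being written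
out entrywise. -/
def IsConjInvariant (f : Matrix (Fin 2) (Fin 2) k × Matrix (Fin 2) (Fin 2) k → k) : Prop :=
  ∀ (X Y : Matrix (Fin 2) (Fin 2) k) (p q r s : k), p * s - q * r = 1 →
    f (!![p, q; r, s] * X * !![s, -q; -r, p], !![p, q; r, s] * Y * !![s, -q; -r, p]) = f (X, Y)

/-- The functions `tr X`, `tr Y`, `tr (X * Y)`, `det X`, `det Y`. -/
def invariants (XY : Matrix (Fin 2) (Fin 2) k × Matrix (Fin 2) (Fin 2) k) : Fin 5 → k :=
  ![XY.1.trace, XY.2.trace, (XY.1 * XY.2).trace, XY.1.det, XY.2.det]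

variable {f g : Matrix (Fin 2) (Fin 2) k × Matrix (Fin 2) (Fin 2) k → k}

theorem IsPolynomial.sub (hf : IsPolynomial f) (hg : IsPolynomial g) :
    IsPolynomial (fun XY => f XY - g XY) := by
  obtain ⟨p, hp⟩ := hf
  obtain ⟨q, hq⟩ := hg
  exact ⟨p - q, fun XY => by simp [hp, hq]⟩

theorem IsConjInvariant.sub (hf : IsConjInvariant f) (hg : IsConjInvariant g) :
    IsConjInvariant (fun XY => f XY - g XY) :=
  fun X Y p q r s h => by simp only [hf X Y p q r s h, hg X Y p q r s h]

theorem isPolynomial_eval_invariants (G : MvPolynomial (Fin 5) k) :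
    IsPolynomial fun XY => MvPolynomial.eval (invariants XY) G := by
  let x : Fin 2 → Fin 2 → Fin 2 → MvPolynomial (Fin 2 × Fin 2 × Fin 2) k :=
    fun i j l => MvPolynomial.X (i, j, l)
  refine ⟨MvPolynomial.bind₁ ![x 0 0 0 + x 0 1 1, x 1 0 0 + x 1 1 1,
    x 0 0 0 * x 1 0 0 + x 0 0 1 * x 1 1 0 + (x 0 1 0 * x 1 0 1 + x 0 1 1 * x 1 1 1),
    x 0 0 0 * x 0 1 1 - x 0 0 1 * x 0 1 0, x 1 0 0 * x 1 1 1 - x 1 0 1 * x 1 1 0] G,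
    fun XY => ?_⟩
  rw [MvPolynomial.eval_bind₁]
  refine congrArg (fun v => MvPolynomial.eval v G) (funext fun i => ?_)
  fin_cases i <;>
    simp [invariants, x, Matrix.trace_fin_two, Matrix.det_fin_two, Matrix.mul_apply,
      Fin.sum_univ_two]

theorem isConjInvariant_eval_invariants (G : MvPolynomial (Fin 5) k) :
    IsConjInvariant fun XY => MvPolynomial.eval (invariants XY) G := by
  intro X Y p q r s h
  set g := !![p, q; r, s]
  set g' := !![s, -q; -r, p]
  have h1 : g' * g = 1 := by
    ext i j
    fin_cases i <;> fin_cases j <;> simp [g, g', Matrix.mul_apply, Fin.sum_univ_two] <;> grind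
  have h2 : g * X * g' * (g * Y * g') = g * (X * Y) * g' := by
    calc _ = g * X * (g' * g) * Y * g' := by simp only [Matrix.mul_assoc]
      _ = _ := by rw [h1]; simp only [Matrix.mul_assoc, Matrix.mul_one]
  have ht : ∀ Z : Matrix (Fin 2) (Fin 2) k, (g * Z * g').trace = Z.trace := fun Z => by
    rw [Matrix.trace_mul_comm, ← Matrix.mul_assoc, h1, Matrix.one_mul]
  have hd : ∀ Z : Matrix (Fin 2) (Fin 2) k, (g * Z * g').det = Z.det := fun Z => by
    rw [Matrix.det_mul_comm, ← Matrix.mul_assoc, h1, Matrix.one_mul]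
  simp only [invariants, h2, ht, hd]

open Polynomial in
theorem IsPolynomial.exists_eval_line (hf : IsPolynomial f)
    (A B : Matrix (Fin 2) (Fin 2) k × Matrix (Fin 2) (Fin 2) k) :
    ∃ U : k[X], ∀ t, f (A + t • B) = U.eval t := by
  obtain ⟨p, hp⟩ := hf
  refine ⟨MvPolynomial.aeval (fun i => C (![A.1, A.2] i.1 i.2.1 i.2.2) +
    X * C (![B.1, B.2] i.1 i.2.1 i.2.2)) p, fun t => ?_⟩
  rw [hp, MvPolynomial.polynomial_eval_aeval]
  congr 2
  funext ⟨i, j, l⟩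
  fin_cases i <;> simp <;> exact mul_comm _ _

theorem IsPolynomial.eq_zero_on_line_of_quadratic [CharZero k] (hf : IsPolynomial f)
    (A B : Matrix (Fin 2) (Fin 2) k × Matrix (Fin 2) (Fin 2) k) {x c : k} (hx : x ≠ 0)
    (h : ∀ t : k, f (A + (x * t ^ 2 + c * t) • B) = 0) (r : k) : f (A + r • B) = 0 := by
  obtain ⟨U, hU⟩ := hf.exists_eval_line A B
  have hU0 : U = 0 := Polynomial.eq_zero_of_forall_eval_quadratic_eq_zero hx (c := c)
    fun t => by rw [← hU, h]
  rw [hU, hU0, Polynomial.eval_zero]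

theorem IsPolynomial.eq_zero_on_line_of_ne_zero [CharZero k] (hf : IsPolynomial f)
    (A B : Matrix (Fin 2) (Fin 2) k × Matrix (Fin 2) (Fin 2) k)
    (h : ∀ t : k, t ≠ 0 → f (A + t • B) = 0) (r : k) : f (A + r • B) = 0 := by
  obtain ⟨U, hU⟩ := hf.exists_eval_line A B
  have : Polynomial.X * U = 0 := by
    apply Polynomial.funext
    intro t
    by_cases ht : t = 0
    · simp [ht]
    · simp [← hU, h t ht]
  rw [hU, (mul_eq_zero.1 this).resolve_left Polynomial.X_ne_zero, Polynomial.eval_zero]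

/-- An invariant polynomial vanishing on all pairs (lower triangular, upper triangular)
vanishes identically. -/
theorem IsPolynomial.eq_zero_of_triangular [CharZero k] (hf : IsPolynomial f)
    (hinv : IsConjInvariant f)
    (h : ∀ a b c d x e, f (!![a, 0; x, b], !![c, e; 0, d]) = 0)
    (XY : Matrix (Fin 2) (Fin 2) k × Matrix (Fin 2) (Fin 2) k) : f XY = 0 := by
  have h1 : ∀ x₁₁ x₁₂ x₂₁ x₂₂ c e d, x₂₁ ≠ 0 →
      f (!![x₁₁, x₁₂; x₂₁, x₂₂], !![c, e; 0, d]) = 0 := by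
    intro x₁₁ x₁₂ x₂₁ x₂₂ c e d hx
    have key := hf.eq_zero_on_line_of_quadratic (!![x₁₁, 0; x₂₁, x₂₂], !![c, e; 0, d])
      (!![0, 1; 0, 0], 0) (c := x₂₂ - x₁₁) hx ?_ x₁₂
    · simpa using key
    intro t
    refine Eq.trans ?_ ((hinv _ _ 1 t 0 1 (by simp)).trans
      (h (x₁₁ - t * x₂₁) (x₂₂ + t * x₂₁) c d x₂₁ (e - t * (d - c))))
    congr 1
    simp
    constructorm* _ ∧ _ <;> ring
  have h2 : ∀ x₁₁ x₁₂ x₂₁ x₂₂ c e d,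
      f (!![x₁₁, x₁₂; x₂₁, x₂₂], !![c, e; 0, d]) = 0 := by
    intro x₁₁ x₁₂ x₂₁ x₂₂ c e d
    have key := hf.eq_zero_on_line_of_ne_zero (!![x₁₁, x₁₂; 0, x₂₂], !![c, e; 0, d])
      (!![0, 0; 1, 0], 0) (fun t ht => by simpa using h1 x₁₁ x₁₂ t x₂₂ c e d ht) x₂₁
    simpa using key
  have h2' : ∀ X c e d, f (X, !![c, e; 0, d]) = 0 := fun X c e d => by
    rw [Matrix.eta_fin_two X]
    exact h2 ..
  have h3 : ∀ X y₁₁ y₁₂ y₂₁ y₂₂, y₁₂ ≠ 0 → f (X, !![y₁₁, y₁₂; y₂₁, y₂₂]) = 0 := by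
    intro X y₁₁ y₁₂ y₂₁ y₂₂ hy
    have key := hf.eq_zero_on_line_of_quadratic (X, !![y₁₁, y₁₂; 0, y₂₂])
      (0, !![0, 0; 1, 0]) (c := y₁₁ - y₂₂) hy ?_ y₂₁
    · simpa using key
    intro t
    refine (hinv _ _ 1 0 (-t) 1 (by simp)).symm.trans (Eq.trans ?_
      (h2' (!![1, 0; -t, 1] * X * !![1, 0; t, 1]) (y₁₁ + t * y₁₂) y₁₂ (y₂₂ - t * y₁₂)))
    congr 1
    simp
    constructorm* _ ∧ _ <;> ring
  obtain ⟨X, Y⟩ := XY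
  have key := hf.eq_zero_on_line_of_ne_zero (X, !![Y 0 0, 0; Y 1 0, Y 1 1])
      (0, !![0, 1; 0, 0]) (fun t ht => by simpa using h3 X (Y 0 0) t (Y 1 0) (Y 1 1) ht) (Y 0 1)
  rw [Matrix.eta_fin_two Y]
  simpa using key

theorem IsPolynomial.triangular_eq_mul [CharZero k] (hf : IsPolynomial f)
    (hinv : IsConjInvariant f) (a b c d x e : k) :
    f (!![a, 0; x, b], !![c, e; 0, d]) = f (!![a, 0; 1, b], !![c, x * e; 0, d]) := by
  obtain ⟨U, hU⟩ := hf.exists_eval_line (!![a, 0; 0, b], !![c, e; 0, d]) (!![0, 0; 1, 0], 0)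
  obtain ⟨V, hV⟩ := hf.exists_eval_line (!![a, 0; 1, b], !![c, 0; 0, d]) (0, !![0, e; 0, 0])
  have key : Polynomial.X * (U - V) = 0 := by
    refine Polynomial.eq_zero_of_forall_eval_quadratic_eq_zero one_ne_zero (c := 0) fun t => ?_
    by_cases ht : t = 0
    · simp [ht]
    have hUV : U.eval (t ^ 2) = V.eval (t ^ 2) := by
      rw [← hU, ← hV, ← hinv _ _ t 0 0 t⁻¹ (by simp [ht])]
      congr 1
      simp
      field_simp
      simp
    simp [hUV]
  have hUV : U = V := sub_eq_zero.1 ((mul_eq_zero.1 key).resolve_left Polynomial.X_ne_zero)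
  have h1 := hU x
  rw [hUV, ← hV] at h1
  simpa using h1

theorem IsConjInvariant.triangular_swap_left (hinv : IsConjInvariant f) (a b c d e : k) :
    f (!![a, 0; 1, b], !![c, e; 0, d]) =
      f (!![b, 0; 1, a], !![c, e + (b - a) * (d - c); 0, d]) := by
  rw [← hinv _ _ 1 (b - a) 0 1 (by simp)]
  congr 1
  simp
  constructorm* _ ∧ _ <;> ring

theorem IsPolynomial.triangular_swap_right [CharZero k] (hf : IsPolynomial f)
    (hinv : IsConjInvariant f) (a b c d e : k) :
    f (!![a, 0; 1, b], !![c, e; 0, d]) =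
      f (!![a, 0; 1, b], !![d, e + (a - b) * (c - d); 0, c]) := by
  have h1 := hf.triangular_eq_mul hinv a b c d e 1
  have h2 := hf.triangular_eq_mul hinv a b d c (e + (a - b) * (c - d)) 1
  rw [mul_one] at h1 h2
  rw [← h1, ← h2, ← hinv _ _ 1 0 (c - d) 1 (by simp)]
  congr 1
  simp
  constructorm* _ ∧ _ <;> ring

/-- Polynomials in `a, b, c, d, s` are spanned by `1, a, c, a * c` over the polynomials in
`a + b, c + d, s, a * b, c * d`. -/
theorem exists_eval_eq_span (q : MvPolynomial (Fin 5) k) :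
    ∃ p₀ p₁ p₂ p₃ : MvPolynomial (Fin 5) k, ∀ a b c d s : k,
      let v := ![a + b, c + d, s, a * b, c * d]
      MvPolynomial.eval ![a, b, c, d, s] q = MvPolynomial.eval v p₀ + MvPolynomial.eval v p₁ * a +
        MvPolynomial.eval v p₂ * c + MvPolynomial.eval v p₃ * (a * c) := by
  induction q using MvPolynomial.induction_on with
  | C r => exact ⟨MvPolynomial.C r, 0, 0, 0, by simp⟩
  | add q₁ q₂ h₁ h₂ =>
    obtain ⟨p₀, p₁, p₂, p₃, hp⟩ := h₁
    obtain ⟨r₀, r₁, r₂, r₃, hr⟩ := h₂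
    refine ⟨p₀ + r₀, p₁ + r₁, p₂ + r₂, p₃ + r₃, fun a b c d s => ?_⟩
    simp only [map_add, hp, hr]
    ring
  | mul_X q i h =>
    obtain ⟨p₀, p₁, p₂, p₃, hp⟩ := h
    let T : Fin 5 → MvPolynomial (Fin 5) k := MvPolynomial.X
    fin_cases i
    · refine ⟨-(p₁ * T 3), p₀ + p₁ * T 0, -(p₃ * T 3), p₂ + p₃ * T 0, fun a b c d s => ?_⟩
      simp [hp, T]
      ring
    · refine ⟨p₀ * T 0 + p₁ * T 3, -p₀, p₂ * T 0 + p₃ * T 3, -p₂, fun a b c d s => ?_⟩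
      simp [hp, T]
      ring
    · refine ⟨-(p₂ * T 4), -(p₃ * T 4), p₀ + p₂ * T 1, p₁ + p₃ * T 1, fun a b c d s => ?_⟩
      simp [hp, T]
      ring
    · refine ⟨p₀ * T 1 + p₂ * T 4, p₁ * T 1 + p₃ * T 4, -p₀, -p₁, fun a b c d s => ?_⟩
      simp [hp, T]
      ring
    · refine ⟨p₀ * T 2, p₁ * T 2, p₂ * T 2, p₃ * T 2, fun a b c d s => ?_⟩
      simp [hp, T]
      ring

theorem exists_eval_eq_of_symmetric [CharZero k] (q : MvPolynomial (Fin 5) k)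
    (hab : ∀ a b c d s,
      MvPolynomial.eval ![a, b, c, d, s] q = MvPolynomial.eval ![b, a, c, d, s] q)
    (hcd : ∀ a b c d s,
      MvPolynomial.eval ![a, b, c, d, s] q = MvPolynomial.eval ![a, b, d, c, s] q) :
    ∃ G : MvPolynomial (Fin 5) k, ∀ a b c d s,
      MvPolynomial.eval ![a, b, c, d, s] q =
        MvPolynomial.eval ![a + b, c + d, s, a * b, c * d] G := by
  obtain ⟨p₀, p₁, p₂, p₃, hp⟩ := exists_eval_eq_span q
  let T : Fin 5 → MvPolynomial (Fin 5) k := MvPolynomial.X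
  refine ⟨MvPolynomial.C 4⁻¹ * (4 * p₀ + 2 * p₁ * T 0 + 2 * p₂ * T 1 + p₃ * T 0 * T 1),
    fun a b c d s => ?_⟩
  have h1 := hp a b c d s
  have h2 := hp b a c d s
  have h3 := hp a b d c s
  have h4 := hp b a d c s
  rw [← hab] at h2
  rw [← hcd] at h3
  rw [← hab, ← hcd] at h4
  simp only [add_comm b a, mul_comm b a, add_comm d c, mul_comm d c] at h1 h2 h3 h4
  simp only [map_mul, map_add, MvPolynomial.eval_C, MvPolynomial.eval_X, map_ofNat, T]
  simp only [Matrix.cons_val_zero, Matrix.cons_val_one]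
  linear_combination (h1 + h2 + h3 + h4) / 4

theorem IsPolynomial.exists_eval_triangular (hf : IsPolynomial f) :
    ∃ q : MvPolynomial (Fin 5) k, ∀ a b c d s,
      MvPolynomial.eval ![a, b, c, d, s] q =
        f (!![a, 0; 1, b], !![c, s - a * c - b * d; 0, d]) := by
  obtain ⟨p, hp⟩ := hf
  let T : Fin 5 → MvPolynomial (Fin 5) k := MvPolynomial.X
  refine ⟨MvPolynomial.bind₁ (fun i => ![!![T 0, 0; 1, T 1],
    !![T 2, T 4 - T 0 * T 2 - T 1 * T 3; 0, T 3]] i.1 i.2.1 i.2.2) p, fun a b c d s => ?_⟩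
  rw [hp, MvPolynomial.eval_bind₁]
  congr 2
  funext ⟨i, j, l⟩
  fin_cases i <;> fin_cases j <;> fin_cases l <;> simp [T]

/-- An invariant polynomial function is a polynomial in the five basic invariants. -/
theorem IsPolynomial.exists_eq_eval_invariants [CharZero k] (hf : IsPolynomial f)
    (hinv : IsConjInvariant f) :
    ∃ G : MvPolynomial (Fin 5) k, ∀ XY, f XY = MvPolynomial.eval (invariants XY) G := by
  obtain ⟨q, hq⟩ := hf.exists_eval_triangular
  obtain ⟨G, hG⟩ := exists_eval_eq_of_symmetric q
    (fun a b c d s => by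
      rw [hq, hq, hinv.triangular_swap_left]
      congr 6
      ring)
    (fun a b c d s => by
      rw [hq, hq, hf.triangular_swap_right hinv]
      congr 6
      ring)
  refine ⟨G, fun XY => sub_eq_zero.1 ?_⟩
  refine (hf.sub (isPolynomial_eval_invariants G)).eq_zero_of_triangular
    (hinv.sub (isConjInvariant_eval_invariants G)) (fun a b c d x e => ?_) XY
  have h := hG a b c d (a * c + (x * e + b * d))
  rw [hq] at h
  rw [hf.triangular_eq_mul hinv, sub_eq_zero]
  convert h using 2
  · congr 6
    ring
  · simp [invariants, Matrix.trace_fin_two, Matrix.det_fin_two]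

end MatrixPair

/-- Let `k` be a field of characteristic zero and `f` a polynomial function on
pairs `(X, Y)` of 2×2 matrices over `k` satisfying
`f (g·X·g⁻¹, g·Y·g⁻¹) = f (X, Y)` for all `X, Y` and all `g ∈ SL₂(k)`.
Then `f` lies in the `k`-subalgebra of functions generated by
`tr X`, `tr Y`, `tr (X·Y)`, `det X` and `det Y`. -/
theorem sl2_invariants_two_loops (k : Type) [Field k] [CharZero k]
    (f : Matrix (Fin 2) (Fin 2) k × Matrix (Fin 2) (Fin 2) k → k)
    (hpoly : ∃ p : MvPolynomial (Fin 2 × Fin 2 × Fin 2) k,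
      ∀ XY : Matrix (Fin 2) (Fin 2) k × Matrix (Fin 2) (Fin 2) k,
        f XY = MvPolynomial.eval (fun i => ![XY.1, XY.2] i.1 i.2.1 i.2.2) p)
    (hinv : ∀ (XY : Matrix (Fin 2) (Fin 2) k × Matrix (Fin 2) (Fin 2) k)
        (g : Matrix.SpecialLinearGroup (Fin 2) k),
      f ((g : Matrix (Fin 2) (Fin 2) k) * XY.1 *
            ((g⁻¹ : Matrix.SpecialLinearGroup (Fin 2) k) : Matrix (Fin 2) (Fin 2) k),
         (g : Matrix (Fin 2) (Fin 2) k) * XY.2 *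
            ((g⁻¹ : Matrix.SpecialLinearGroup (Fin 2) k) : Matrix (Fin 2) (Fin 2) k)) = f XY) :
    f ∈ Algebra.adjoin k
      ({fun XY => XY.1.trace, fun XY => XY.2.trace,
        fun XY => (XY.1 * XY.2).trace,
        fun XY => XY.1.det, fun XY => XY.2.det} :
        Set (Matrix (Fin 2) (Fin 2) k × Matrix (Fin 2) (Fin 2) k → k)) := by
  have hconj : MatrixPair.IsConjInvariant f := by
    intro X Y p q r s h
    obtain ⟨g, hg⟩ : ∃ g : Matrix.SpecialLinearGroup (Fin 2) k,
        (g : Matrix (Fin 2) (Fin 2) k) = !![p, q; r, s] :=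
      ⟨⟨!![p, q; r, s], by rw [Matrix.det_fin_two_of, h]⟩, rfl⟩
    have := hinv (X, Y) g
    rwa [Matrix.SpecialLinearGroup.coe_inv, hg, Matrix.adjugate_fin_two_of] at this
  obtain ⟨G, hG⟩ := MatrixPair.IsPolynomial.exists_eq_eval_invariants hpoly hconj
  have hf : f = MvPolynomial.aeval (fun i XY => MatrixPair.invariants XY i) G := by
    funext XY
    rw [hG, MvPolynomial.aeval_pi_apply]
  rw [hf]
  refine Algebra.adjoin_mono ?_ (Algebra.adjoin_range_eq_range_aeval k
    (fun i XY => MatrixPair.invariants (k := k) XY i) ▸ AlgHom.mem_range_self _ G)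
  rintro _ ⟨i, rfl⟩
  fin_cases i <;> simp [MatrixPair.invariants]
end

section
/- Let k be a field of characteristic zero and let Q be a finite quiver with vertex set Q₀ and arrow set Q₁, with head and tail maps h, t : Q₁ → Q₀. A 2-representation of Q assigns to each arrow a ∈ Q₁ a 2×2 matrix φ_a over k; the group G = ∏_{v ∈ Q₀} SL₂(k) acts on the space of 2-representations by (g·φ)_a = g_{h(a)} · φ_a · g_{t(a)}⁻¹. Let Q̃ be the doubled quiver obtained from Q by adding, for each arrow a, a reversed arrow ā from h(a) to t(a); a route is an oriented cycle in Q̃, i.e., a cyclic sequence of arrows of Q̃ in which the head of each arrow equals the tail of the next; a route is simple if no arrow of Q̃ occurs in it more than once. The trace of a route at a representation φ is the trace of the product, taken along the cycle, of the matrices φ_a for each original arrow a traversed and adjugate(φ_a) for each reversed arrow ā traversed. Then the k-algebra of all G-invariant polynomial functions on the space of 2-representations (polynomials in the entries of the matrices φ_a) is generated by the traces of simple routes. -/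
/-- The space of 2×2 matrices over `k`. -/
abbrev Mat2 (k : Type*) := Matrix (Fin 2) (Fin 2) k

section TwoByTwo

variable {k : Type*} [Field k]

/-- The adjugate of 2×2 matrices, as a linear map. -/
def adjugateLinear : Mat2 k →ₗ[k] Mat2 k where
  toFun X := X.adjugate
  map_add' X Y := by
    ext i j; fin_cases i <;> fin_cases j <;> simp [Matrix.adjugate_fin_two, add_comm]
  map_smul' c X := by
    ext i j; fin_cases i <;> fin_cases j <;> simp [Matrix.adjugate_fin_two]

@[simp]
theorem adjugateLinear_apply (X : Mat2 k) : adjugateLinear X = X.adjugate := rfl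

theorem adjugate_adjugate_two (X : Mat2 k) : X.adjugate.adjugate = X := by
  ext i j; fin_cases i <;> fin_cases j <;> simp [Matrix.adjugate_fin_two]

theorem sum_single_self : ∑ p : Fin 2, Matrix.single p p (1 : k) = 1 := by
  ext i j; fin_cases i <;> fin_cases j <;> simp [Matrix.single]

theorem adjugate_single (p q : Fin 2) :
    (Matrix.single p q (1 : k)).adjugate = (if p = q then 1 else 0) - Matrix.single p q 1 := by
  ext i j
  fin_cases p <;> fin_cases q <;> fin_cases i <;> fin_cases j <;>
    simp [Matrix.adjugate_fin_two, Matrix.single]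

theorem single_one_mul (p q : Fin 2) (X : Mat2 k) :
    Matrix.single p q 1 * X = ∑ j, X q j • Matrix.single p j 1 := by
  ext a b
  fin_cases p <;> fin_cases q <;> fin_cases a <;> fin_cases b <;>
    simp [Matrix.mul_apply, Matrix.single, Fin.sum_univ_two]

theorem mul_single_one (p q : Fin 2) (X : Mat2 k) :
    X * Matrix.single p q 1 = ∑ i, X i p • Matrix.single i q 1 := by
  ext a b
  fin_cases p <;> fin_cases q <;> fin_cases a <;> fin_cases b <;>
    simp [Matrix.mul_apply, Matrix.single, Fin.sum_univ_two]

/-- The tensor `∑ E_pq ⊗ E_qp` intertwines right multiplication on the first factor with left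
multiplication on the second. -/
theorem sum_single_mul_right (β : Mat2 k →ₗ[k] Mat2 k →ₗ[k] k) (A : Mat2 k) :
    ∑ p, ∑ q, β (Matrix.single p q 1 * A) (Matrix.single q p 1) =
      ∑ p, ∑ q, β (Matrix.single p q 1) (A * Matrix.single q p 1) := by
  simp only [single_one_mul, mul_single_one, Fin.sum_univ_two, map_add, map_smul,
    LinearMap.add_apply, LinearMap.smul_apply, smul_eq_mul]
  ring

/-- The tensor `∑ E_pq ⊗ E_qp` intertwines left multiplication on the first factor with right
multiplication on the second. -/
theorem sum_single_mul_left (β : Mat2 k →ₗ[k] Mat2 k →ₗ[k] k) (A : Mat2 k) :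
    ∑ p, ∑ q, β (A * Matrix.single p q 1) (Matrix.single q p 1) =
      ∑ p, ∑ q, β (Matrix.single p q 1) (Matrix.single q p 1 * A) := by
  simp only [single_one_mul, mul_single_one, Fin.sum_univ_two, map_add, map_smul,
    LinearMap.add_apply, LinearMap.smul_apply, smul_eq_mul]
  ring

theorem sum_single_mul_mul (β : Mat2 k →ₗ[k] Mat2 k →ₗ[k] k) (A B C D : Mat2 k)
    (hCD : C * D = 1) :
    ∑ p, ∑ q, β (C * (Matrix.single p q 1 * A)) (B * Matrix.single q p 1 * D) =
      ∑ p, ∑ q, β (Matrix.single p q 1) (B * A * Matrix.single q p 1) := by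
  have h1 := sum_single_mul_left
    (β.compl₁₂ (LinearMap.mulRight k A) (LinearMap.mulRight k D ∘ₗ LinearMap.mulLeft k B)) C
  have h2 := sum_single_mul_right (β.compl₂ (LinearMap.mulLeft k B)) A
  simp only [LinearMap.compl₁₂_apply, LinearMap.compl₂_apply, LinearMap.comp_apply,
    LinearMap.mulRight_apply, LinearMap.mulLeft_apply, Matrix.mul_assoc, hCD, Matrix.mul_one]
    at h1 h2 ⊢
  rw [h1, h2]

/-- A linear form on 2×2 matrices that vanishes on nilpotent matrices is a multiple of the
trace. -/
theorem linearForm_eq_trace_of_nilpotent [CharZero k] (Φ : Mat2 k →ₗ[k] k)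
    (hΦ : ∀ N : Mat2 k, N.trace = 0 → N.det = 0 → Φ N = 0) (M : Mat2 k) :
    Φ M = M.trace / 2 * Φ 1 := by
  have h01 := hΦ !![0, 1; 0, 0] (by simp [Matrix.trace_fin_two]) (by simp [Matrix.det_fin_two])
  have h10 := hΦ !![0, 0; 1, 0] (by simp [Matrix.trace_fin_two]) (by simp [Matrix.det_fin_two])
  have h := hΦ !![1, -1; 1, -1] (by simp [Matrix.trace_fin_two]) (by simp [Matrix.det_fin_two])
  have hM : M = (M.trace / 2) • (1 : Mat2 k) + ((M 0 0 - M 1 1) / 2) • !![1, -1; 1, -1] +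
      (M 0 1 + (M 0 0 - M 1 1) / 2) • !![0, 1; 0, 0] +
      (M 1 0 - (M 0 0 - M 1 1) / 2) • !![0, 0; 1, 0] := by
    ext i j
    fin_cases i <;> fin_cases j <;> simp [Matrix.trace_fin_two] <;> ring
  conv_lhs => rw [hM]
  simp only [map_add, map_smul, h01, h10, h, smul_eq_mul, mul_zero, add_zero]

end TwoByTwo

section Multilinear

open Function

variable {k : Type*} [Field k] {K : Type*} [DecidableEq K]

/-- The first-order term of a multilinear map along a quadratic curve on which it is constant
vanishes. -/
theorem MultilinearMap.sum_update_eq_zero_of_forall_curve [Infinite k] [Fintype K] {E : Type*}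
    [AddCommGroup E] [Module k E] (F : MultilinearMap k (fun _ : K => E) k) (X Y Z : K → E)
    (h : ∀ t : k, F (fun l => X l + t • Y l + t ^ 2 • Z l) = F X) :
    ∑ l, F (update X l (Y l)) = 0 := by
  let W : K → Fin 3 → E := fun l => ![X l, Y l, Z l]
  let P : Polynomial k := ∑ r : K → Fin 3,
    Polynomial.C (F fun l => W l (r l)) * Polynomial.X ^ (∑ l, (r l : ℕ))
  have hP : P = Polynomial.C (F X) := by
    refine Polynomial.funext fun t => ?_
    have := F.map_sum (fun l (j : Fin 3) => t ^ (j : ℕ) • W l j)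
    simp only [F.map_smul_univ] at this
    rw [Polynomial.eval_C, ← h t]
    simp only [P, Polynomial.eval_finsetSum, Polynomial.eval_mul, Polynomial.eval_C,
      Polynomial.eval_pow, Polynomial.eval_X]
    simp only [Fin.sum_univ_three, W, Finset.prod_pow_eq_pow_sum, smul_eq_mul] at this
    simp at this
    rw [this]
    exact Finset.sum_congr rfl fun r _ => mul_comm _ _
  have hc := congrArg (fun p => Polynomial.coeff p 1) hP
  simp only [P, Polynomial.finsetSum_coeff, Polynomial.coeff_C_mul, Polynomial.coeff_X_pow,
    Polynomial.coeff_C, one_ne_zero, if_false, mul_ite, mul_one, mul_zero] at hc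
  rw [← Finset.sum_filter] at hc
  rw [← hc]
  refine Finset.sum_bij (fun l _ => Pi.single l 1) ?_ ?_ ?_ ?_
  · intro l _
    rw [Finset.mem_filter]
    refine ⟨Finset.mem_univ _, ?_⟩
    rw [Finset.sum_eq_single l]
    · simp
    · intro b _ hb; simp [hb]
    · simp
  · intro a _ b _ hab
    by_contra hne
    have := congrFun hab a
    simp [hne] at this
  · intro r hr
    rw [Finset.mem_filter] at hr
    obtain ⟨l, hl⟩ : ∃ l, r l ≠ 0 := by
      by_contra! h0
      simp [h0] at hr
    have h1 := Finset.add_sum_erase Finset.univ (fun l => (r l : ℕ)) (Finset.mem_univ l)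
    have h2 : (r l : ℕ) ≠ 0 := fun h0 => hl (Fin.ext h0)
    have h3 : ∑ x ∈ Finset.univ.erase l, (r x : ℕ) = 0 := by omega
    have h4 : (r l : ℕ) = 1 := by omega
    refine ⟨l, Finset.mem_univ _, ?_⟩
    funext j
    by_cases hj : j = l
    · subst hj; simp [Fin.ext_iff, h4]
    · have := (Finset.sum_eq_zero_iff.mp h3) j (by simp [hj])
      simp [hj, Fin.ext_iff, this]
  · intro l _
    congr 1
    funext j
    by_cases hj : j = l
    · subst hj; simp [W]
    · simp [hj, W]

/-- The bilinear form obtained from a multilinear map by freezing all but two arguments. -/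
def MultilinearMap.pairForm {E : Type*} [AddCommGroup E] [Module k E]
    (F : MultilinearMap k (fun _ : K => E) k) (Y : K → E) {s l : K} (hsl : s ≠ l) :
    E →ₗ[k] E →ₗ[k] k :=
  LinearMap.mk₂ k (fun A B => F (update (update Y s A) l B))
    (fun A A' B => by simp [update_comm hsl])
    (fun c A B => by simp [update_comm hsl])
    (fun A B B' => by simp)
    (fun c A B => by simp)

@[simp]
theorem MultilinearMap.pairForm_apply {E : Type*} [AddCommGroup E] [Module k E]
    (F : MultilinearMap k (fun _ : K => E) k) (Y : K → E) {s l : K} (hsl : s ≠ l) (A B : E) :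
    F.pairForm Y hsl A B = F (update (update Y s A) l B) := rfl

end Multilinear

section Invariant

open Function

variable {k : Type*} [Field k] {V Ω : Type*} {K : Type*}

/-- Invariance of a multilinear function of matrices, the matrix with index `l` being viewed as an
arrow from `t l` to `h l`, under a copy of `SL₂` at every vertex. -/
def IsQuiverInvariant (h t : K → V) (F : MultilinearMap k (fun _ : K => Mat2 k) k) : Prop :=
  ∀ (g : V → Matrix.SpecialLinearGroup (Fin 2) k) (X : K → Mat2 k),
    F (fun l => (g (h l) : Mat2 k) * X l *
      (((g (t l))⁻¹ : Matrix.SpecialLinearGroup (Fin 2) k) : Mat2 k)) = F X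

/-- The action of the Lie algebra of the group at the vertex `v` on a multilinear function. -/
def infinitesimalAction [DecidableEq V] [Fintype K] [DecidableEq K] (h t : K → V)
    (F : MultilinearMap k (fun _ : K => Mat2 k) k) (v : V) (X : K → Mat2 k) : Mat2 k →ₗ[k] k :=
  ∑ l, F.toLinearMap X l ∘ₗ ((if h l = v then LinearMap.mulRight k (X l) else 0) +
    (if t l = v then LinearMap.mulLeft k (X l) ∘ₗ adjugateLinear else 0))

theorem infinitesimalAction_apply [DecidableEq V] [Fintype K] [DecidableEq K] (h t : K → V)
    (F : MultilinearMap k (fun _ : K => Mat2 k) k) (v : V) (X : K → Mat2 k) (M : Mat2 k) :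
    infinitesimalAction h t F v X M =
      ∑ l, F (update X l ((if h l = v then M * X l else 0) +
        (if t l = v then X l * M.adjugate else 0))) := by
  simp only [infinitesimalAction, LinearMap.sum_apply]
  refine Finset.sum_congr rfl fun l _ => ?_
  split_ifs <;> simp

theorem IsQuiverInvariant.infinitesimalAction_nilpotent [CharZero k] [DecidableEq V] [Fintype K]
    [DecidableEq K] {h t : K → V} {F : MultilinearMap k (fun _ : K => Mat2 k) k}
    (hF : IsQuiverInvariant h t F) (v : V) (X : K → Mat2 k) (N : Mat2 k) (htr : N.trace = 0)
    (hdet : N.det = 0) : infinitesimalAction h t F v X N = 0 := by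
  rw [infinitesimalAction_apply]
  refine F.sum_update_eq_zero_of_forall_curve X _
    (fun l => if h l = v ∧ t l = v then N * X l * N.adjugate else 0) fun c => ?_
  have hadj : ∀ M : Mat2 k, (1 + c • M).adjugate = 1 + c • M.adjugate := fun M => by
    simpa using adjugateLinear.map_add (1 : Mat2 k) (c • M)
  have hd : (1 + c • N).det = 1 := by
    rw [Matrix.trace_fin_two] at htr
    rw [Matrix.det_fin_two] at hdet
    simp [Matrix.det_fin_two]
    linear_combination c * htr + c ^ 2 * hdet
  obtain ⟨G, hG⟩ : ∃ G : Matrix.SpecialLinearGroup (Fin 2) k, (G : Mat2 k) = 1 + c • N :=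
    ⟨⟨_, hd⟩, rfl⟩
  rw [← hF (fun u => if u = v then G else 1) X]
  congr 1
  funext l
  by_cases h1 : h l = v <;> by_cases h2 : t l = v <;>
    simp [h1, h2, hG, hadj, add_mul, mul_add, Matrix.mul_assoc, pow_two,
      smul_smul]
  abel

theorem IsQuiverInvariant.sum_infinitesimalAction [CharZero k] [DecidableEq V] [Fintype K]
    [DecidableEq K] {h t : K → V} {F : MultilinearMap k (fun _ : K => Mat2 k) k}
    (hF : IsQuiverInvariant h t F) (s : K) (X : K → Mat2 k) :
    ∑ p, ∑ q, infinitesimalAction h t F (h s) (update X s (Matrix.single p q 1 * X s))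
        (Matrix.single q p 1) =
      ((∑ l, ((if h l = h s then 1 else 0) + (if t l = h s then 1 else 0)) : ℕ) : k) / 2 *
        F X := by
  have hone : ∀ Y, infinitesimalAction h t F (h s) Y 1 =
      ((∑ l, ((if h l = h s then 1 else 0) + (if t l = h s then 1 else 0)) : ℕ) : k) * F Y := by
    intro Y
    rw [infinitesimalAction_apply, Nat.cast_sum, Finset.sum_mul]
    refine Finset.sum_congr rfl fun l _ => ?_
    split_ifs <;> simp [two_mul]
  have hsum : F X = ∑ p, F (update X s (Matrix.single p p 1 * X s)) := by
    rw [← F.map_update_sum, ← Finset.sum_mul, sum_single_self, Matrix.one_mul, update_eq_self]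
  have htrace : ∀ Y M, infinitesimalAction h t F (h s) Y M = _ := fun Y M =>
    (linearForm_eq_trace_of_nilpotent _ (hF.infinitesimalAction_nilpotent (h s) Y) M).trans
      (congrArg _ (hone Y))
  simp only [htrace]
  rw [hsum, Finset.mul_sum]
  refine Finset.sum_congr rfl fun p _ => ?_
  rw [Finset.sum_eq_single p]
  · simp [Matrix.trace_single_eq_same]; ring
  · intro q _ hq
    simp [Matrix.trace_single_eq_of_ne _ _ _ hq]
  · simp

/-- A family of matrix-valued functions indexed by pairs of vertices, closed under composition and
adjugation, whose closed members have their traces in a given algebra of functions. -/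
structure IsTraceSystem (P : V → V → Set (Ω → Mat2 k)) (T : Subalgebra k (Ω → k)) : Prop where
  mul_mem {u v w x y} : x ∈ P u v → y ∈ P v w → y * x ∈ P u w
  adjugate_mem {u v x} : x ∈ P u v → (fun ω => (x ω).adjugate) ∈ P v u
  trace_mem {v x} : x ∈ P v v → (fun ω => (x ω).trace) ∈ T

/-- Every invariant multilinear function in arguments indexed by `K` takes values in `T` at members
of `P`. -/
def InvariantsMem (P : V → V → Set (Ω → Mat2 k)) (T : Subalgebra k (Ω → k)) (K : Type*) : Prop :=
  ∀ (h t : K → V) (F : MultilinearMap k (fun _ : K => Mat2 k) k), IsQuiverInvariant h t F →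
    ∀ X : K → Ω → Mat2 k, (∀ l, X l ∈ P (t l) (h l)) → (fun ω => F fun l => X l ω) ∈ T

variable [DecidableEq K] {P : V → V → Set (Ω → Mat2 k)} {T : Subalgebra k (Ω → k)}

/-- The multilinear function obtained by contracting the head of the arrow `s` with the tail of the
arrow `l`. -/
def contraction (F : MultilinearMap k (fun _ : K => Mat2 k) k) (s l : K) :
    MultilinearMap k (fun _ : {j // j ≠ s} => Mat2 k) k :=
  ∑ p, ∑ q, (F.compLinearMap fun j =>
    if j = l then LinearMap.mulRight k (Matrix.single q p 1) else LinearMap.id).domDomRestrict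
      (· ≠ s) fun _ => Matrix.single p q 1

theorem contraction_apply (F : MultilinearMap k (fun _ : K => Mat2 k) k) {s l : K} (hsl : s ≠ l)
    (Y : K → Mat2 k) :
    contraction F s l (fun j => Y j) = ∑ p, ∑ q,
      F.pairForm Y hsl (Matrix.single p q 1) (Y l * Matrix.single q p 1) := by
  simp only [contraction, sum_apply, MultilinearMap.domDomRestrict_apply,
    MultilinearMap.compLinearMap_apply, MultilinearMap.pairForm_apply]
  refine Finset.sum_congr rfl fun p _ => Finset.sum_congr rfl fun q _ => ?_
  congr 1
  funext j
  by_cases hl : j = l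
  · subst hl; simp [hsl.symm]
  · by_cases hs : j = s
    · subst hs; simp [hl]
    · simp [hl, hs]

theorem IsQuiverInvariant.contraction {h t : K → V} {F : MultilinearMap k (fun _ : K => Mat2 k) k}
    (hF : IsQuiverInvariant h t F) {s l : K} (hsl : s ≠ l) (hst : h s = t l) :
    IsQuiverInvariant (fun j : {j // j ≠ s} => h j)
      (fun j : {j // j ≠ s} => if j = l then t s else t j) (contraction F s l) := by
  intro g X
  let Y : K → Mat2 k := fun j => if hj : j ≠ s then X ⟨j, hj⟩ else 0
  have hXY : X = fun j : {j // j ≠ s} => Y j := by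
    funext j; simp [Y, j.2]
  let Z : K → Mat2 k := fun j => (g (h j) : Mat2 k) * Y j *
    (((g (if j = l then t s else t j))⁻¹ : Matrix.SpecialLinearGroup (Fin 2) k) : Mat2 k)
  have hZ : (fun j : {j // j ≠ s} => (g (h j) : Mat2 k) * X j *
      (((g (if (j : K) = l then t s else t j))⁻¹ : Matrix.SpecialLinearGroup (Fin 2) k) :
        Mat2 k)) = fun j : {j // j ≠ s} => Z j := by
    funext j; simp only [Z, hXY]
  rw [hZ, contraction_apply F hsl, hXY, contraction_apply F hsl]
  have key := sum_single_mul_mul (F.pairForm Z hsl)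
    (((g (t s))⁻¹ : Matrix.SpecialLinearGroup (Fin 2) k) : Mat2 k) ((g (h l) : Mat2 k) * Y l)
    (g (h s) : Mat2 k) (((g (h s))⁻¹ : Matrix.SpecialLinearGroup (Fin 2) k) : Mat2 k)
    (by rw [← Matrix.SpecialLinearGroup.coe_mul, mul_inv_cancel,
      Matrix.SpecialLinearGroup.coe_one])
  have hZl : Z l = (g (h l) : Mat2 k) * Y l *
    (((g (t s))⁻¹ : Matrix.SpecialLinearGroup (Fin 2) k) : Mat2 k) := by simp only [Z, if_true]
  rw [hZl, ← key]
  refine Finset.sum_congr rfl fun p _ => Finset.sum_congr rfl fun q _ => ?_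
  simp only [MultilinearMap.pairForm_apply]
  refine Eq.trans ?_ (hF g _)
  congr 1
  funext j
  by_cases hl : j = l
  · subst hl; simp [hst, Matrix.mul_assoc]
  · by_cases hs : j = s
    · subst hs; simp [hl, Matrix.mul_assoc]
    · simp [hl, hs, Z]

theorem contraction_mem (hPT : IsTraceSystem P T) {h t : K → V}
    {F : MultilinearMap k (fun _ : K => Mat2 k) k} (hF : IsQuiverInvariant h t F) {s l : K}
    (hsl : s ≠ l) (hst : h s = t l) (hK : InvariantsMem P T {j // j ≠ s})
    {X : K → Ω → Mat2 k} (hX : ∀ j, X j ∈ P (t j) (h j)) :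
    (fun ω => ∑ p, ∑ q, F (update (update (fun j => X j ω) s (Matrix.single p q 1 * X s ω)) l
      (X l ω * Matrix.single q p 1))) ∈ T := by
  have := hK _ _ _ (hF.contraction hsl hst) (fun j => if (j : K) = l then X l * X s else X j) ?_
  · convert this using 2 with ω
    have h1 := contraction_apply F hsl (fun j => if j = l then X l ω * X s ω else X j ω)
    have h2 := sum_single_mul_mul (F.pairForm (fun j => X j ω) hsl) (X s ω) (X l ω) 1 1
      (Matrix.one_mul 1)
    simp only [Matrix.one_mul, Matrix.mul_one, MultilinearMap.pairForm_apply] at h2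
    rw [h2]
    trans contraction F s l (fun j => (fun j => if j = l then X l ω * X s ω else X j ω) (j : K))
    · rw [h1]
      refine Finset.sum_congr rfl fun p _ => Finset.sum_congr rfl fun q _ => ?_
      simp only [MultilinearMap.pairForm_apply]
      congr 1
      funext j
      by_cases hl : j = l
      · subst hl; simp
      · by_cases hs : j = s
        · subst hs; simp [hl]
        · simp [hl, hs]
    · congr 1
      funext j
      by_cases hj : (j : K) = l <;> simp [hj]
  · intro j
    split_ifs with hj
    · rw [hj]
      exact hPT.mul_mem (hX s) (hst ▸ hX l)
    · exact hX j

/-- Reversing the arrow `l`. -/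
theorem IsQuiverInvariant.reverse {h t : K → V} {F : MultilinearMap k (fun _ : K => Mat2 k) k}
    (hF : IsQuiverInvariant h t F) (l : K) :
    IsQuiverInvariant (update h l (t l)) (update t l (h l)) (F.compLinearMap fun j =>
      if j = l then adjugateLinear else LinearMap.id) := by
  intro g X
  simp only [MultilinearMap.compLinearMap_apply]
  refine Eq.trans ?_ (hF g _)
  congr 1
  funext j
  by_cases hj : j = l
  · subst hj
    simp [Matrix.adjugate_mul_distrib, adjugate_adjugate_two, Matrix.mul_assoc]
  · simp [hj]

theorem contraction_head_mem (hPT : IsTraceSystem P T) {h t : K → V}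
    {F : MultilinearMap k (fun _ : K => Mat2 k) k} (hF : IsQuiverInvariant h t F) {s l : K}
    (hsl : s ≠ l) (hst : h s = h l) (hK : InvariantsMem P T {j // j ≠ s})
    {X : K → Ω → Mat2 k} (hX : ∀ j, X j ∈ P (t j) (h j)) :
    (fun ω => ∑ p, ∑ q, F (update (update (fun j => X j ω) s (Matrix.single p q 1 * X s ω)) l
      ((Matrix.single q p 1).adjugate * X l ω))) ∈ T := by
  have := contraction_mem hPT (hF.reverse l) hsl (by simp [hsl, hst]) hK
    (X := update X l fun ω => (X l ω).adjugate) ?_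
  · convert this using 2 with ω
    refine Finset.sum_congr rfl fun p _ => Finset.sum_congr rfl fun q _ => ?_
    rw [MultilinearMap.compLinearMap_apply]
    congr 1
    funext j
    by_cases hl : j = l
    · subst hl
      simp [Matrix.adjugate_mul_distrib, adjugate_adjugate_two]
    · by_cases hs : j = s
      · subst hs; simp [hl]
      · simp [hl, hs]
  · intro j
    by_cases hj : j = l
    · subst hj
      simpa using hPT.adjugate_mem (hX j)
    · simpa [hj] using hX j

theorem sum_ite_single_mul (F : MultilinearMap k (fun _ : K => Mat2 k) k) {s l : K}
    (hsl : s ≠ l) (X : K → Mat2 k) :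
    ∑ p, ∑ q, F (update (update X s (Matrix.single p q 1 * X s)) l
      (if q = p then X l else 0)) = F X := by
  have h1 : ∀ p q, F (update (update X s (Matrix.single p q 1 * X s)) l
      (if q = p then X l else 0)) =
        if q = p then F.toLinearMap X s (Matrix.single p q 1 * X s) else 0 := by
    intro p q
    split_ifs
    · rw [update_comm hsl, update_eq_self]; rfl
    · exact F.map_coord_zero l (by simp)
  simp only [h1, Finset.sum_ite_eq', Finset.mem_univ, if_true]
  rw [← map_sum, ← Finset.sum_mul, sum_single_self, Matrix.one_mul]
  change F (update X s (X s)) = _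
  rw [update_eq_self]

theorem tail_term_add_contraction (F : MultilinearMap k (fun _ : K => Mat2 k) k) {s l : K}
    (hsl : s ≠ l) (X : K → Mat2 k) :
    ∑ p, ∑ q, F (update (update X s (Matrix.single p q 1 * X s)) l
      (X l * (Matrix.single q p 1).adjugate)) +
    ∑ p, ∑ q, F (update (update X s (Matrix.single p q 1 * X s)) l
      (X l * Matrix.single q p 1)) = F X := by
  rw [← sum_ite_single_mul F hsl X]
  simp only [← Finset.sum_add_distrib, ← F.map_update_add, ← Matrix.mul_add]
  refine Finset.sum_congr rfl fun p _ => Finset.sum_congr rfl fun q _ => ?_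
  rw [adjugate_single, sub_add_cancel, mul_ite, Matrix.mul_one, Matrix.mul_zero]

theorem head_term_add_contraction (F : MultilinearMap k (fun _ : K => Mat2 k) k) {s l : K}
    (hsl : s ≠ l) (X : K → Mat2 k) :
    ∑ p, ∑ q, F (update (update X s (Matrix.single p q 1 * X s)) l
      (Matrix.single q p 1 * X l)) +
    ∑ p, ∑ q, F (update (update X s (Matrix.single p q 1 * X s)) l
      ((Matrix.single q p 1).adjugate * X l)) = F X := by
  rw [← sum_ite_single_mul F hsl X]
  simp only [← Finset.sum_add_distrib, ← F.map_update_add, ← Matrix.add_mul]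
  refine Finset.sum_congr rfl fun p _ => Finset.sum_congr rfl fun q _ => ?_
  rw [adjugate_single, add_sub_cancel, ite_mul, Matrix.one_mul, Matrix.zero_mul]

theorem loop_head_term (F : MultilinearMap k (fun _ : K => Mat2 k) k) (s : K) (X : K → Mat2 k) :
    ∑ p, ∑ q, F (update X s (Matrix.single q p 1 * (Matrix.single p q 1 * X s))) =
      2 * F X := by
  simp only [← F.map_update_sum]
  have : ∑ p : Fin 2, ∑ q : Fin 2, Matrix.single q p (1 : k) * (Matrix.single p q 1 * X s) =
      (2 : k) • X s := by
    simp only [← Matrix.mul_assoc, Matrix.single_mul_single_same, mul_one, ← Finset.sum_mul,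
      sum_single_self, Finset.sum_const]
    ext i j
    simp [two_smul, two_mul, add_mul]
  rw [this, F.map_update_smul, update_eq_self, smul_eq_mul]

theorem loop_tail_term (F : MultilinearMap k (fun _ : K => Mat2 k) k) (s : K) (X : K → Mat2 k) :
    ∑ p, ∑ q, F (update X s (Matrix.single p q 1 * X s * (Matrix.single q p 1).adjugate)) +
      (X s).trace * F (update X s 1) = F X := by
  have : ∑ p : Fin 2, ∑ q : Fin 2,
      Matrix.single p q (1 : k) * X s * (Matrix.single q p 1).adjugate =
        X s - (X s).trace • (1 : Mat2 k) := by
    ext i j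
    fin_cases i <;> fin_cases j <;>
      simp [Fin.sum_univ_two, Matrix.adjugate_fin_two, Matrix.mul_apply, Matrix.single,
        Matrix.trace_fin_two]
  simp only [← F.map_update_sum]
  rw [this, F.map_update_sub, F.map_update_smul, update_eq_self, smul_eq_mul, sub_add_cancel]

theorem loop_mem (hPT : IsTraceSystem P T) {h t : K → V}
    {F : MultilinearMap k (fun _ : K => Mat2 k) k} (hF : IsQuiverInvariant h t F) {s : K}
    (hs : h s = t s) (hK : InvariantsMem P T {j // j ≠ s})
    {X : K → Ω → Mat2 k} (hX : ∀ j, X j ∈ P (t j) (h j)) :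
    (fun ω => (X s ω).trace * F (update (fun j => X j ω) s 1)) ∈ T := by
  refine T.mul_mem (hPT.trace_mem (v := h s) (by simpa [hs] using hX s)) ?_
  have := hK (fun j => h j) (fun j => t j) (F.domDomRestrict (· ≠ s) fun _ => 1) ?_
    (fun j => X j) (fun j => hX j)
  · convert this using 2 with ω
    rw [MultilinearMap.domDomRestrict_apply]
    congr 1
    funext j
    by_cases hj : j = s
    · subst hj; simp
    · simp [hj]
  · intro g Y
    simp only [MultilinearMap.domDomRestrict_apply]
    refine Eq.trans ?_ (hF g _)
    congr 1
    funext j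
    by_cases hj : j = s
    · subst hj
      simp only [ne_eq, not_true_eq_false, dite_false, Matrix.mul_one, hs]
      rw [← Matrix.SpecialLinearGroup.coe_mul, mul_inv_cancel, Matrix.SpecialLinearGroup.coe_one]
    · simp [hj]

theorem invariantsMem_of_remove [CharZero k] [Fintype K] (hPT : IsTraceSystem P T)
    (hK : ∀ s : K, InvariantsMem P T {j // j ≠ s}) : InvariantsMem P T K := by
  classical
  intro h t F hF X hX
  rcases isEmpty_or_nonempty K with hE | ⟨⟨s⟩⟩
  · convert T.algebraMap_mem (F fun l => 0) using 1
    funext ω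
    exact congrArg F (funext fun l => hE.elim l)
  set f : Ω → k := fun ω => F fun l => X l ω with hf
  let c : K → ℕ := fun l => (if h l = h s then 1 else 0) + (if t l = h s then 1 else 0)
  let e : K → Ω → k := fun l ω =>
    ∑ p, ∑ q, F (update (update (fun j => X j ω) s (Matrix.single p q 1 * X s ω)) l
      ((if h l = h s then
          Matrix.single q p 1 * update (fun j => X j ω) s (Matrix.single p q 1 * X s ω) l else 0) +
        (if t l = h s then update (fun j => X j ω) s (Matrix.single p q 1 * X s ω) l *
          (Matrix.single q p 1).adjugate else 0)))
  have he : ∑ l, e l = (((∑ l, c l : ℕ) : k) / 2) • f := by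
    funext ω
    have := hF.sum_infinitesimalAction s (fun j => X j ω)
    simp only [infinitesimalAction_apply] at this
    simp only [Finset.sum_apply, e, Pi.smul_apply, smul_eq_mul, hf, c]
    rw [← this, Finset.sum_comm]
    refine Finset.sum_congr rfl fun p _ => ?_
    rw [Finset.sum_comm]
  have hs : e s - ((c s + 1 : ℕ) : k) • f ∈ T := by
    by_cases hst : h s = t s
    · convert T.neg_mem (loop_mem hPT hF hst (hK s) hX) using 1
      funext ω
      have h1 := loop_head_term F s (fun j => X j ω)
      have h2 := loop_tail_term F s (fun j => X j ω)
      simp only [Pi.sub_apply, Pi.smul_apply, Pi.neg_apply, smul_eq_mul, e, c, hf, if_true,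
        update_self, update_idem, ← hst, F.map_update_add, Finset.sum_add_distrib]
      rw [h1]
      push_cast
      linear_combination h2
    · convert T.zero_mem using 1
      funext ω
      have h1 := loop_head_term F s (fun j => X j ω)
      simp only [Pi.sub_apply, Pi.smul_apply, Pi.zero_apply, smul_eq_mul, e, c, hf, if_true,
        update_self, update_idem, Ne.symm hst, if_false, add_zero]
      rw [h1]
      push_cast
      ring
  have hl : ∀ l, l ≠ s → e l - (c l : k) • f ∈ T := by
    intro l hls
    have hhead : h l = h s → (fun ω => ∑ p, ∑ q,
        F (update (update (fun j => X j ω) s (Matrix.single p q 1 * X s ω)) l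
          (Matrix.single q p 1 * X l ω))) - f ∈ T := by
      intro hh
      convert T.neg_mem (contraction_head_mem hPT hF hls.symm hh.symm (hK s) hX) using 1
      funext ω
      have := head_term_add_contraction F hls.symm (fun j => X j ω)
      simp only [Pi.sub_apply, Pi.neg_apply, hf]
      linear_combination this
    have htail : t l = h s → (fun ω => ∑ p, ∑ q,
        F (update (update (fun j => X j ω) s (Matrix.single p q 1 * X s ω)) l
          (X l ω * (Matrix.single q p 1).adjugate))) - f ∈ T := by
      intro ht
      convert T.neg_mem (contraction_mem hPT hF hls.symm ht.symm (hK s) hX) using 1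
      funext ω
      have := tail_term_add_contraction F hls.symm (fun j => X j ω)
      simp only [Pi.sub_apply, Pi.neg_apply, hf]
      linear_combination this
    have hzero : ∀ (Y : K → Mat2 k), F (update Y l 0) = 0 := fun Y => F.map_coord_zero l (by simp)
    by_cases hh : h l = h s <;> by_cases ht : t l = h s
    · convert T.add_mem (hhead hh) (htail ht) using 1
      funext ω
      simp only [Pi.sub_apply, Pi.smul_apply, Pi.add_apply, smul_eq_mul, e, c, hh, ht, if_true,
        update_of_ne hls, F.map_update_add, Finset.sum_add_distrib]
      push_cast
      ring
    · convert hhead hh using 1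
      funext ω
      simp [e, c, hh, ht, update_of_ne hls]
    · convert htail ht using 1
      funext ω
      simp [e, c, hh, ht, update_of_ne hls]
    · convert T.zero_mem using 1
      funext ω
      simp [e, c, hh, ht, hzero]
  have hsum : (∑ l, e l) - ((∑ l, c l + 1 : ℕ) : k) • f ∈ T := by
    convert T.add_mem hs (T.sum_mem fun l (hm : l ∈ Finset.univ.erase s) =>
      hl l (Finset.ne_of_mem_erase hm)) using 1
    rw [Finset.sum_sub_distrib, ← Finset.sum_smul, ← Finset.add_sum_erase _ e (Finset.mem_univ s),
      ← Finset.add_sum_erase _ c (Finset.mem_univ s)]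
    push_cast
    module
  rw [he, ← sub_smul] at hsum
  have hne : ((∑ l, c l : ℕ) : k) / 2 - ((∑ l, c l + 1 : ℕ) : k) ≠ 0 := by
    have h2 : ((∑ l, c l + 2 : ℕ) : k) ≠ 0 := Nat.cast_ne_zero.mpr (by omega)
    intro h0
    apply h2
    push_cast at h0 ⊢
    linear_combination (-2) * h0
  have := T.smul_mem hsum (((∑ l, c l : ℕ) : k) / 2 - ((∑ l, c l + 1 : ℕ) : k))⁻¹
  rwa [smul_smul, inv_mul_cancel₀ hne, one_smul] at this

/-- First fundamental theorem for multilinear invariants of quiver representations of dimension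
two. -/
theorem IsTraceSystem.invariantsMem [CharZero k] (hPT : IsTraceSystem P T) (L : Type*)
    [Finite L] : InvariantsMem P T L := by
  classical
  induction hn : Nat.card L using Nat.strong_induction_on generalizing L with
  | _ n ih =>
    have := Fintype.ofFinite L
    refine invariantsMem_of_remove hPT fun s => ih _ ?_ {j // j ≠ s} rfl
    rw [← hn]
    exact Finite.card_subtype_lt (x := s) (by simp)

end Invariant

section Routes

variable {k : Type*} [Field k] {V A : Type*} (hd tl : A → V)

/-- `IsPath hd tl u v w` says that the arrows in `w`, read from right to left, form a path from `u`
to `v` in the doubled quiver. -/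
def IsPath (u : V) : V → List (A ⊕ A) → Prop
  | v, [] => u = v
  | v, b :: w => Sum.elim hd tl b = v ∧ IsPath u (Sum.elim tl hd b) w

/-- The product of matrices along a path in the doubled quiver. -/
def pathMatrix (w : List (A ⊕ A)) (φ : A → Mat2 k) : Mat2 k :=
  (w.map (Sum.elim (fun a => φ a) (fun a => (φ a).adjugate))).prod

variable {hd tl}

theorem pathMatrix_append (p q : List (A ⊕ A)) (φ : A → Mat2 k) :
    pathMatrix (p ++ q) φ = pathMatrix p φ * pathMatrix q φ := by
  simp [pathMatrix]

theorem pathMatrix_cons (b : A ⊕ A) (q : List (A ⊕ A)) (φ : A → Mat2 k) :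
    pathMatrix (b :: q) φ =
      Sum.elim (fun a => φ a) (fun a => (φ a).adjugate) b * pathMatrix q φ := by
  simp [pathMatrix]

theorem isPath_append {u v : V} {p q : List (A ⊕ A)} :
    IsPath hd tl u v (p ++ q) ↔ ∃ x, IsPath hd tl x v p ∧ IsPath hd tl u x q := by
  induction p generalizing v with
  | nil => simp [IsPath]
  | cons b p ih => simp [IsPath, ih, and_assoc]

theorem IsPath.reverse {u v : V} {w : List (A ⊕ A)} (hw : IsPath hd tl u v w) :
    IsPath hd tl v u (w.map Sum.swap).reverse := by
  induction w generalizing v with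
  | nil => exact hw.symm
  | cons b w ih =>
    obtain ⟨rfl, hw⟩ := hw
    rw [List.map_cons, List.reverse_cons, isPath_append]
    refine ⟨_, ih hw, ?_⟩
    rcases b with a | a <;> simp [IsPath]

theorem pathMatrix_reverse (w : List (A ⊕ A)) (φ : A → Mat2 k) :
    pathMatrix (w.map Sum.swap).reverse φ = (pathMatrix w φ).adjugate := by
  induction w with
  | nil => simp [pathMatrix]
  | cons b w ih =>
    rw [List.map_cons, List.reverse_cons, pathMatrix_append, ih, pathMatrix_cons b w,
      Matrix.adjugate_mul_distrib]
    rcases b with a | a <;> simp [pathMatrix, adjugate_adjugate_two]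

theorem IsPath.elim_getElem_succ {u v : V} {w : List (A ⊕ A)} (hw : IsPath hd tl u v w) (i : ℕ)
    (hi : i + 1 < w.length) : Sum.elim tl hd w[i] = Sum.elim hd tl w[i + 1] := by
  induction w generalizing v i with
  | nil => simp at hi
  | cons b w ih =>
    cases i with
    | zero =>
      cases w with
      | nil => simp at hi
      | cons c w => exact hw.2.1.symm
    | succ i => exact ih hw.2 i (by simpa using hi)

theorem IsPath.elim_getElem_zero {u v : V} {w : List (A ⊕ A)} (hw : IsPath hd tl u v w)
    (hi : 0 < w.length) : Sum.elim hd tl w[0] = v := by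
  cases w with
  | nil => simp at hi
  | cons b w => exact hw.1

theorem IsPath.elim_getElem_last {u v : V} {w : List (A ⊕ A)} (hw : IsPath hd tl u v w) (i : ℕ)
    (hi : i + 1 = w.length) : Sum.elim tl hd w[i] = u := by
  induction w generalizing v i with
  | nil => simp at hi
  | cons b w ih =>
    cases i with
    | zero =>
      cases w with
      | nil => exact hw.2.symm
      | cons c w => simp at hi
    | succ i => exact ih hw.2 i (by simpa using hi)

variable (k hd tl) in
/-- The traces of simple routes. -/
def simpleRouteTraces : Set ((A → Mat2 k) → k) :=
  {F | ∃ (m : ℕ) (c : Fin (m + 1) → A ⊕ A),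
    (∀ q, Sum.elim hd tl (c q) = Sum.elim tl hd (c (q + 1))) ∧
    Function.Injective c ∧
    F = fun φ =>
      ((List.ofFn fun q =>
        Sum.elim (fun a => φ a) (fun a => (φ a).adjugate) (c q)).reverse.prod).trace}

theorem IsPath.trace_mem_simpleRouteTraces {v : V} {w : List (A ⊕ A)} (hw : IsPath hd tl v v w)
    (hne : w ≠ []) (hnd : w.Nodup) :
    (fun φ => (pathMatrix w φ).trace) ∈ simpleRouteTraces k hd tl := by
  obtain ⟨m, hm⟩ : ∃ m, w.length = m + 1 :=
    ⟨w.length - 1, by have := List.length_pos_iff.mpr hne; omega⟩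
  refine ⟨m, fun q => w[m - q], fun q => ?_, fun p q hpq => ?_, ?_⟩
  · rcases eq_or_ne q (Fin.last m) with rfl | hq
    · simp only [Fin.val_last, Fin.last_add_one, Nat.sub_self, Fin.val_zero, Nat.sub_zero]
      rw [hw.elim_getElem_zero, hw.elim_getElem_last _ hm.symm]
    · have hlt : q < Fin.last m := Fin.lt_last_iff_ne_last.mpr hq
      have hlt' : (q : ℕ) < m := hlt
      have hval : ((q + 1 : Fin (m + 1)) : ℕ) = q + 1 := Fin.val_add_one_of_lt hlt
      have hidx : m - (q + 1 : Fin (m + 1)) + 1 = m - q := by omega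
      rw [hw.elim_getElem_succ (m - (q + 1 : Fin (m + 1))) (by omega)]
      simp only [hidx]
  · have := (List.Nodup.getElem_inj_iff hnd).mp hpq
    have h1 := p.2
    have h2 := q.2
    exact Fin.ext (by omega)
  · funext φ
    have : (List.ofFn fun q : Fin (m + 1) =>
        Sum.elim (fun a => φ a) (fun a => (φ a).adjugate) (w[m - (q : ℕ)]'(by omega))).reverse =
        w.map (Sum.elim (fun a => φ a) (fun a => (φ a).adjugate)) := by
      apply List.ext_getElem
      · simp [hm]
      · intro i h1 h2
        simp only [List.length_map] at h2
        simp only [List.getElem_reverse, List.getElem_ofFn, List.length_ofFn, List.getElem_map]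
        congr 2
        omega
    rw [this]
    rfl

theorem det_mem_adjoin_simpleRouteTraces [CharZero k] (a : A) :
    (fun φ : A → Mat2 k => (φ a).det) ∈ Algebra.adjoin k (simpleRouteTraces k hd tl) := by
  have hp : IsPath hd tl (hd a) (hd a) [Sum.inl a, Sum.inr a] := by simp [IsPath]
  have := Algebra.subset_adjoin (R := k) (hp.trace_mem_simpleRouteTraces (k := k) (by simp)
    (by simp))
  convert Subalgebra.smul_mem _ this (2⁻¹ : k) using 1
  funext φ
  simp [pathMatrix, Matrix.mul_adjugate]
  field_simp

theorem trace_mul_mul_mul (B U W : Mat2 k) :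
    (B * U * B * W).trace =
      (B * U).trace * (B * W).trace - B.det * (U.adjugate * W).trace := by
  simp only [Matrix.trace_fin_two, Matrix.mul_apply, Fin.sum_univ_two, Matrix.det_fin_two,
    Matrix.adjugate_fin_two, Matrix.of_apply, Matrix.cons_val', Matrix.cons_val_zero,
    Matrix.cons_val_one, Matrix.cons_val_fin_one]
  ring

/-- The trace of a closed path is a polynomial in the traces of simple routes. -/
theorem IsPath.trace_mem_adjoin [CharZero k] {v : V} {w : List (A ⊕ A)}
    (hw : IsPath hd tl v v w) :
    (fun φ => (pathMatrix w φ).trace) ∈ Algebra.adjoin k (simpleRouteTraces k hd tl) := by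
  induction hn : w.length using Nat.strong_induction_on generalizing v w with
  | _ n ih =>
    rcases eq_or_ne w [] with rfl | hne
    · convert (Algebra.adjoin k (simpleRouteTraces k hd tl)).algebraMap_mem 2 using 1
      funext φ
      simp [pathMatrix]
    by_cases hnd : w.Nodup
    · exact Algebra.subset_adjoin (hw.trace_mem_simpleRouteTraces hne hnd)
    rw [List.nodup_iff_sublist] at hnd
    push Not at hnd
    obtain ⟨b, hb⟩ := hnd
    obtain ⟨r₁, r₂, rfl, h1, h2⟩ := List.cons_sublist_iff.mp hb
    obtain ⟨p, q₁, rfl⟩ := List.append_of_mem h1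
    obtain ⟨q₂, r, rfl⟩ := List.append_of_mem (List.singleton_sublist.mp h2)
    have hsplit : p ++ b :: q₁ ++ (q₂ ++ b :: r) = p ++ b :: ((q₁ ++ q₂) ++ b :: r) := by simp
    rw [hsplit] at hw hn ⊢
    generalize q₁ ++ q₂ = q at hw hn ⊢
    obtain ⟨x, hp, rfl, hw⟩ := isPath_append.mp hw
    obtain ⟨x, hq, rfl, hr⟩ := isPath_append.mp hw
    have hrp := isPath_append.mpr ⟨_, hr, hp⟩
    simp only [List.length_append, List.length_cons] at hn
    have t1 := ih (b :: q).length (by simp; omega) (w := b :: q) ⟨rfl, hq⟩ rfl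
    have t2 := ih (b :: (r ++ p)).length (by simp; omega) (w := b :: (r ++ p)) ⟨rfl, hrp⟩ rfl
    have t3 := ih ((q.map Sum.swap).reverse ++ (r ++ p)).length (by simp; omega)
      (isPath_append.mpr ⟨_, hq.reverse, hrp⟩) rfl
    have t4 : (fun φ : A → Mat2 k =>
        (Sum.elim (fun a => φ a) (fun a => (φ a).adjugate) b).det) ∈
          Algebra.adjoin k (simpleRouteTraces k hd tl) := by
      rcases b with a | a
      · exact det_mem_adjoin_simpleRouteTraces a
      · convert det_mem_adjoin_simpleRouteTraces (k := k) (hd := hd) (tl := tl) a using 2 with φ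
        simp [Matrix.det_adjugate]
    convert Subalgebra.sub_mem _ (Subalgebra.mul_mem _ t1 t2) (Subalgebra.mul_mem _ t4 t3) using 1
    funext φ
    simp only [Pi.sub_apply, Pi.mul_apply, pathMatrix_append, pathMatrix_cons, pathMatrix_reverse]
    rw [← trace_mul_mul_mul, Matrix.trace_mul_comm]
    simp only [Matrix.mul_assoc]

theorem isTraceSystem_pathMatrix [CharZero k] :
    IsTraceSystem (fun u v => {x : (A → Mat2 k) → Mat2 k |
      ∃ w, IsPath hd tl u v w ∧ x = pathMatrix w})
      (Algebra.adjoin k (simpleRouteTraces k hd tl)) where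
  mul_mem := by
    rintro u v w _ _ ⟨p, hp, rfl⟩ ⟨q, hq, rfl⟩
    exact ⟨q ++ p, isPath_append.mpr ⟨_, hq, hp⟩, funext fun φ => (pathMatrix_append q p φ).symm⟩
  adjugate_mem := by
    rintro u v _ ⟨p, hp, rfl⟩
    exact ⟨_, hp.reverse, funext fun φ => (pathMatrix_reverse p φ).symm⟩
  trace_mem := by
    rintro v _ ⟨p, hp, rfl⟩
    exact hp.trace_mem_adjoin

end Routes

section Polarization

variable {k : Type*} [Field k] {E : Type*} [AddCommGroup E] [Module k E] {d : ℕ}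

/-- The symmetrization of a multilinear map, without normalization. -/
def MultilinearMap.polarization (M : MultilinearMap k (fun _ : Fin d => E) k) :
    MultilinearMap k (fun _ : Fin d => E) k :=
  ∑ e : Equiv.Perm (Fin d), M.domDomCongr e

theorem MultilinearMap.polarization_apply (M : MultilinearMap k (fun _ : Fin d => E) k)
    (x : Fin d → E) : M.polarization x = ∑ e : Equiv.Perm (Fin d), M fun i => x (e i) := by
  simp [MultilinearMap.polarization, sum_apply, MultilinearMap.domDomCongr_apply]

theorem MultilinearMap.polarization_diagonal (M : MultilinearMap k (fun _ : Fin d => E) k)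
    (x : E) : M.polarization (fun _ => x) = (d.factorial : k) * M fun _ => x := by
  simp [MultilinearMap.polarization_apply, Fintype.card_perm]

theorem sum_powerset_prod_ite (r : Fin d → Fin d) :
    ∑ t : Finset (Fin d), (-1 : k) ^ t.card * ∏ i, (if r i ∈ t then 0 else 1) =
      if Function.Surjective r then 1 else 0 := by
  classical
  have h := Finset.prod_sub (fun _ => (1 : k)) (fun j => if ∃ i, r i = j then 0 else 1)
    (Finset.univ : Finset (Fin d))
  have hprod : ∏ j, ((1 : k) - if ∃ i, r i = j then 0 else 1) =
      if Function.Surjective r then 1 else 0 := by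
    split_ifs with hr
    · exact Finset.prod_eq_one fun j _ => by simp [hr j]
    · rw [Function.Surjective] at hr
      push Not at hr
      obtain ⟨j, hj⟩ := hr
      exact Finset.prod_eq_zero (Finset.mem_univ j) (by simp [hj])
  rw [← hprod, h, Finset.powerset_univ]
  refine Finset.sum_congr rfl fun t _ => ?_
  rw [Finset.prod_const_one, mul_one]
  congr 1
  by_cases ht : ∃ i, r i ∈ t
  · obtain ⟨i, hi⟩ := ht
    rw [Finset.prod_eq_zero (Finset.mem_univ i) (by simp [hi]),
      Finset.prod_eq_zero hi (by simp)]
  · push Not at ht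
    rw [Finset.prod_eq_one fun i _ => by simp [ht i], Finset.prod_eq_one]
    intro j hj
    rw [if_neg]
    rintro ⟨i, rfl⟩
    exact ht i hj

/-- The polarization formula. -/
theorem MultilinearMap.polarization_eq_sum (M : MultilinearMap k (fun _ : Fin d => E) k)
    (x : Fin d → E) :
    M.polarization x = ∑ t : Finset (Fin d),
      (-1 : k) ^ t.card * M fun _ => ∑ j, (if j ∈ t then (0 : k) else 1) • x j := by
  classical
  simp only [M.map_sum, M.map_smul_univ, smul_eq_mul, Finset.mul_sum]
  rw [Finset.sum_comm]
  simp only [← mul_assoc, ← Finset.sum_mul, sum_powerset_prod_ite, ite_mul, one_mul, zero_mul]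
  rw [MultilinearMap.polarization_apply]
  refine Finset.sum_of_injOn (fun e : Equiv.Perm (Fin d) => (e : Fin d → Fin d)) ?_ ?_ ?_ ?_
  · exact fun _ _ _ _ h => Equiv.coe_fn_injective h
  · exact fun _ _ => Finset.mem_coe.mpr (Finset.mem_univ _)
  · intro r _ hr
    rw [if_neg]
    intro hs
    exact hr ⟨Equiv.ofBijective r (Finite.surjective_iff_bijective.mp hs), by simp, rfl⟩
  · intro e _
    simp [e.surjective]

/-- Polarization preserves invariance under linear maps. -/
theorem MultilinearMap.polarization_comp (M : MultilinearMap k (fun _ : Fin d => E) k)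
    (L : E →ₗ[k] E) (hL : ∀ x, (M fun _ => L x) = M fun _ => x) (x : Fin d → E) :
    M.polarization (fun i => L (x i)) = M.polarization x := by
  rw [MultilinearMap.polarization_eq_sum, MultilinearMap.polarization_eq_sum]
  refine Finset.sum_congr rfl fun t _ => ?_
  have h : ∑ j, (if j ∈ t then (0 : k) else 1) • L (x j) =
      L (∑ j, (if j ∈ t then (0 : k) else 1) • x j) := by
    simp only [_root_.map_sum, _root_.map_smul]
  rw [h, hL]

theorem exists_prod_eq_of_degree_eq {σ : Type*} {m : σ →₀ ℕ} (hm : m.degree = d) :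
    ∃ y : Fin d → σ, ∀ x : σ → k, ∏ i, x (y i) = m.prod fun a n => x a ^ n := by
  classical
  have hlen : m.toMultiset.toList.length = d := by
    rw [Multiset.length_toList, Finsupp.card_toMultiset, ← hm]
    rfl
  subst hlen
  refine ⟨fun i => m.toMultiset.toList[i], fun x => ?_⟩
  have hprod : ∏ i : Fin m.toMultiset.toList.length, x m.toMultiset.toList[i] =
      (m.toMultiset.toList.map x).prod := by
    rw [← List.prod_ofFn]
    congr 1
    apply List.ext_getElem <;> simp
  rw [hprod, ← Multiset.prod_coe, ← Multiset.map_coe, Multiset.coe_toList,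
    Finsupp.toMultiset_map, Finsupp.prod_toMultiset,
    Finsupp.prod_mapDomain_index (fun _ => pow_zero _) (fun _ _ _ => pow_add _ _ _)]

theorem exists_multilinearMap_homogeneousComponent {σ : Type*} (p : MvPolynomial σ k) (d : ℕ) :
    ∃ M : MultilinearMap k (fun _ : Fin d => σ → k) k,
      ∀ x, MvPolynomial.eval x (MvPolynomial.homogeneousComponent d p) = M fun _ => x := by
  have hmon : ∀ m : σ →₀ ℕ, ∃ M : MultilinearMap k (fun _ : Fin d => σ → k) k,
      m.degree = d → ∀ x, (M fun _ => x) = m.prod fun a n => x a ^ n := by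
    intro m
    by_cases hm : m.degree = d
    · obtain ⟨y, hy⟩ := exists_prod_eq_of_degree_eq (k := k) hm
      refine ⟨(MultilinearMap.mkPiAlgebra k (Fin d) k).compLinearMap fun i =>
        LinearMap.proj (y i), fun _ x => ?_⟩
      rw [← hy]
      simp
    · exact ⟨0, fun h => (hm h).elim⟩
  choose M hM using hmon
  refine ⟨∑ m ∈ p.support with m.degree = d, p.coeff m • M m, fun x => ?_⟩
  rw [MvPolynomial.homogeneousComponent_apply, map_sum, sum_apply]
  refine Finset.sum_congr rfl fun m hm => ?_
  rw [MvPolynomial.eval_monomial, smul_apply, hM m (Finset.mem_filter.mp hm).2,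
    smul_eq_mul]

/-- The homogeneous parts of an invariant function are invariant. -/
theorem diagonal_comp_eq_of_sum [Infinite k] {N : ℕ}
    (M : ∀ d, MultilinearMap k (fun _ : Fin d => E) k) (L : E →ₗ[k] E)
    (hL : ∀ x, (∑ d ∈ Finset.range N, M d fun _ => L x) = ∑ d ∈ Finset.range N, M d fun _ => x)
    {d : ℕ} (hd : d ∈ Finset.range N) (x : E) : (M d fun _ => L x) = M d fun _ => x := by
  let P : Polynomial k := ∑ d ∈ Finset.range N,
    Polynomial.C ((M d fun _ => L x) - M d fun _ => x) * Polynomial.X ^ d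
  have hP : P = 0 := by
    refine Polynomial.funext fun c => ?_
    have := hL (c • x)
    simp only [map_smul, (M _).map_smul_univ (fun _ => c), Finset.prod_const, Finset.card_univ,
      Fintype.card_fin, smul_eq_mul] at this
    simp only [P, Polynomial.eval_finsetSum, Polynomial.eval_mul, Polynomial.eval_C,
      Polynomial.eval_pow, Polynomial.eval_X, Polynomial.eval_zero, sub_mul,
      Finset.sum_sub_distrib]
    rw [sub_eq_zero]
    simpa only [mul_comm] using this
  have hc := congrArg (fun p => Polynomial.coeff p d) hP
  simp only [P, Polynomial.finsetSum_coeff, Polynomial.coeff_C_mul_X_pow,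
    Finset.sum_ite_eq, hd, if_true, Polynomial.coeff_zero] at hc
  exact sub_eq_zero.mp hc

end Polarization

section Semiinvariants

variable {k : Type*} [Field k] {V A : Type*}

/-- The action of an element of the group on representations, as a linear map. -/
def actionLinear (hd tl : A → V) (g : V → Matrix.SpecialLinearGroup (Fin 2) k) :
    (A → Mat2 k) →ₗ[k] (A → Mat2 k) :=
  LinearMap.pi fun a => LinearMap.mulRight k
    (((g (tl a))⁻¹ : Matrix.SpecialLinearGroup (Fin 2) k) : Mat2 k) ∘ₗ
      LinearMap.mulLeft k (g (hd a) : Mat2 k) ∘ₗ LinearMap.proj a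

theorem diagonal_mem_adjoin_of_invariant [CharZero k] [Fintype A] {hd tl : A → V} {d : ℕ}
    (M : MultilinearMap k (fun _ : Fin d => A → Mat2 k) k)
    (hM : ∀ g φ, (M fun _ => actionLinear hd tl g φ) = M fun _ => φ) :
    (fun φ => M fun _ => φ) ∈ Algebra.adjoin k (simpleRouteTraces k hd tl) := by
  classical
  have hterm : ∀ w : Fin d → A,
      (fun φ : A → Mat2 k => M.polarization fun i => Pi.single (w i) (φ (w i))) ∈
        Algebra.adjoin k (simpleRouteTraces k hd tl) := by
    intro w
    refine isTraceSystem_pathMatrix.invariantsMem (Fin d) (fun i => hd (w i)) (fun i => tl (w i))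
      (M.polarization.compLinearMap fun i => LinearMap.single k (fun _ : A => Mat2 k) (w i)) ?_
      (fun i φ => φ (w i)) fun i => ?_
    · intro g X
      simp only [MultilinearMap.compLinearMap_apply]
      refine Eq.trans ?_ (M.polarization_comp (actionLinear hd tl g) (hM g) _)
      congr 1
      funext i a
      by_cases ha : a = w i
      · subst ha; simp [actionLinear]
      · simp [actionLinear, ha]
    · exact ⟨[Sum.inl (w i)], by simp [IsPath], by funext φ; simp [pathMatrix]⟩
  have hfac : (d.factorial : k) ≠ 0 := Nat.cast_ne_zero.mpr d.factorial_ne_zero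
  convert Subalgebra.smul_mem _ (Subalgebra.sum_mem _ fun w (_ : w ∈ Finset.univ) => hterm w)
    (d.factorial : k)⁻¹ using 1
  funext φ
  have := M.polarization.map_sum (fun (_ : Fin d) (a : A) => Pi.single a (φ a))
  simp only [Finset.univ_sum_single, M.polarization_diagonal] at this
  rw [Pi.smul_apply, Finset.sum_apply, ← this, smul_eq_mul, inv_mul_cancel_left₀ hfac]

end Semiinvariants

/-- **Semi-invariants of 2-representations of quivers** (the paper's Theorem 2).

Let `k` be a field of characteristic zero and `Q` a finite quiver with vertices
`V`, arrows `A` and head/tail maps `hd, tl : A → V`.  A 2-representation assigns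
a 2×2 matrix `φ a` to each arrow `a`, and `G = ∏_{v ∈ V} SL₂(k)` acts by
`(g·φ) a = g (hd a) * φ a * (g (tl a))⁻¹`.

Arrows of the doubled quiver `Q̃` are modelled by `A ⊕ A`: `Sum.inl a` is the
original arrow `a` (head `hd a`, tail `tl a`) and `Sum.inr a` the reversed
arrow `ā` (head `tl a`, tail `hd a`).  A route is a cyclic sequence
`c : Fin (m+1) → A ⊕ A` with the head of each arrow equal to the tail of the
next; it is simple when `c` is injective.  Its trace at `φ` is the trace of the
product along the cycle (composing maps, so the matrices are multiplied in
reverse order of traversal) of `φ a` for original arrows and `(φ a).adjugate`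
for reversed arrows.

Then every `G`-invariant polynomial function `f` on the representation space
lies in the `k`-subalgebra of functions generated by the traces of simple
routes. -/
theorem semi_invariants_of_two_representations
    (k : Type) [Field k] [CharZero k]
    (V A : Type) [Fintype V] [Fintype A]
    (hd tl : A → V)
    (f : (A → Matrix (Fin 2) (Fin 2) k) → k)
    (hpoly : ∃ p : MvPolynomial (A × Fin 2 × Fin 2) k,
      ∀ φ : A → Matrix (Fin 2) (Fin 2) k,
        f φ = MvPolynomial.eval (fun x => φ x.1 x.2.1 x.2.2) p)
    (hinv : ∀ (g : V → Matrix.SpecialLinearGroup (Fin 2) k)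
        (φ : A → Matrix (Fin 2) (Fin 2) k),
      f (fun a => (g (hd a) : Matrix (Fin 2) (Fin 2) k) * φ a *
          (((g (tl a))⁻¹ : Matrix.SpecialLinearGroup (Fin 2) k) :
            Matrix (Fin 2) (Fin 2) k)) = f φ) :
    f ∈ Algebra.adjoin k
      {F : (A → Matrix (Fin 2) (Fin 2) k) → k |
        ∃ (m : ℕ) (c : Fin (m + 1) → A ⊕ A),
          (∀ q, Sum.elim hd tl (c q) = Sum.elim tl hd (c (q + 1))) ∧
          Function.Injective c ∧
          F = fun φ =>
            ((List.ofFn fun q =>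
                Sum.elim (fun a => φ a) (fun a => (φ a).adjugate)
                  (c q)).reverse.prod).trace} := by
  classical
  obtain ⟨p, hp⟩ := hpoly
  choose M hM using exists_multilinearMap_homogeneousComponent p
  let coords : (A → Mat2 k) →ₗ[k] (A × Fin 2 × Fin 2 → k) :=
    { toFun := fun φ x => φ x.1 x.2.1 x.2.2
      map_add' := fun _ _ => rfl
      map_smul' := fun _ _ => rfl }
  let M' : ∀ d, MultilinearMap k (fun _ : Fin d => A → Mat2 k) k := fun d =>
    (M d).compLinearMap fun _ => coords
  have hf : ∀ φ, f φ = ∑ d ∈ Finset.range (p.totalDegree + 1), M' d fun _ => φ := by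
    intro φ
    rw [hp, ← MvPolynomial.sum_homogeneousComponent p, map_sum,
      MvPolynomial.sum_homogeneousComponent p]
    exact Finset.sum_congr rfl fun d _ => hM d _
  have hL : ∀ g φ, f (actionLinear hd tl g φ) = f φ := hinv
  have hfsum : f = ∑ d ∈ Finset.range (p.totalDegree + 1), fun φ => M' d fun _ => φ := by
    funext φ
    rw [hf, Finset.sum_apply]
  rw [hfsum]
  refine Subalgebra.sum_mem _ fun d hd' => diagonal_mem_adjoin_of_invariant (M' d) fun g φ => ?_
  refine diagonal_comp_eq_of_sum M' (actionLinear hd tl g) (fun x => ?_) hd' φ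
  rw [← hf, ← hf, hL]
end
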